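/- Let 𝒜 be the Weyl algebra, n ≥ 1, and let ℂ[S_n] ⋉ 𝒜^{⊗n} be the crossed product for the permutation action of S_n on 𝒜^{⊗n}. Then for every i ≥ 0 the Hochschild cohomology HH^i(ℂ[S_n] ⋉ 𝒜^{⊗n}) is finite-dimensional over ℂ, of dimension equal to the number of partitions λ of n with 2(n − ℓ(λ)) = i, where ℓ(λ) is the number of parts of λ. In particular HH^i = 0 when i is odd. -/

import Mathlib

open TensorProduct CategoryTheory MulOpposite

noncomputable section

/-- The enveloping algebra `S ⊗[ℂ] Sᵐᵒᵖ` of a `ℂ`-algebra `S`. -/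
abbrev env (S : Type) [Ring S] [Algebra ℂ S] : Type := S ⊗[ℂ] Sᵐᵒᵖ

/-- `S` as a left module over its enveloping algebra (via `(x ⊗ yᵒᵖ) • s = x * s * y`). -/
abbrev envBimod (S : Type) [Ring S] [Algebra ℂ S] : ModuleCat (env S) :=
  @ModuleCat.of (env S) _ S _ (TensorProduct.Algebra.module)

/-- Hochschild cohomology with coefficients: `HH^i(S, N) = Ext^i_{S^e}(S, N)`. -/
abbrev HHext (S : Type) [Ring S] [Algebra ℂ S] (i : ℕ) (N : ModuleCat (env S)) : ModuleCat ℂ :=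
  ((Ext ℂ (ModuleCat (env S)) i).obj (Opposite.op (envBimod S))).obj N

/-- Hochschild cohomology `HH^i(S) = Ext^i_{S^e}(S, S)`. -/
abbrev HHcoh (S : Type) [Ring S] [Algebra ℂ S] (i : ℕ) : ModuleCat ℂ :=
  HHext S i (envBimod S)

/-- The defining relation of the Weyl algebra: `x p = p x + 1`
(generators: `0 ↦ x`, `1 ↦ p`). -/
inductive weylRel : FreeAlgebra ℂ (Fin 2) → FreeAlgebra ℂ (Fin 2) → Prop
  | rel : weylRel (FreeAlgebra.ι ℂ 0 * FreeAlgebra.ι ℂ 1)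
      (FreeAlgebra.ι ℂ 1 * FreeAlgebra.ι ℂ 0 + 1)

/-- The Weyl algebra `𝒜`: the quotient of the free algebra on `x, p`
by the two-sided ideal generated by `xp - px - 1`. -/
abbrev Weyl : Type := RingQuot weylRel

/-- The generator `x` of the Weyl algebra. -/
def Weyl.x : Weyl := RingQuot.mkAlgHom ℂ weylRel (FreeAlgebra.ι ℂ 0)

/-- The generator `p` of the Weyl algebra. -/
def Weyl.p : Weyl := RingQuot.mkAlgHom ℂ weylRel (FreeAlgebra.ι ℂ 1)

/-- The `n`-fold tensor power `A^{⊗n}` of a `ℂ`-algebra `A` (over `ℂ`). -/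
abbrev tpow (A : Type) [Ring A] [Algebra ℂ A] (n : ℕ) : Type := ⨂[ℂ] (_ : Fin n), A

section Koszul

open AlternatingMap

variable {V M M' : Type} [AddCommGroup V] [Module ℂ V] [AddCommGroup M] [Module ℂ M]
  [AddCommGroup M'] [Module ℂ M']

theorem alternatingMap_sum_apply {κ : Type} (s : Finset κ) {j : ℕ} (f : κ → V [⋀^Fin j]→ₗ[ℂ] M)
    (v : Fin j → V) : (∑ k ∈ s, f k) v = ∑ k ∈ s, f k v := by
  classical
  induction s using Finset.induction_on with
  | empty => simp
  | insert a s ha ih => rw [Finset.sum_insert ha, Finset.sum_insert ha, AlternatingMap.add_apply, ih]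

/-- The Koszul differential of a family of operators `T : V → End M`. -/
def kd (T : V →ₗ[ℂ] Module.End ℂ M) (j : ℕ) :
    (V [⋀^Fin j]→ₗ[ℂ] M) →ₗ[ℂ] (V [⋀^Fin (j + 1)]→ₗ[ℂ] M) :=
  alternatizeUncurryFinLM ∘ₗ
    LinearMap.mk₂ ℂ (fun (f : V [⋀^Fin j]→ₗ[ℂ] M) (v : V) => (T v).compAlternatingMap f)
      (fun f g v => by ext; simp) (fun c f v => by ext; simp)
      (fun f v w => by ext; simp) (fun c f v => by ext; simp)

theorem kd_apply (T : V →ₗ[ℂ] Module.End ℂ M) {j : ℕ} (f : V [⋀^Fin j]→ₗ[ℂ] M)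
    (v : Fin (j + 1) → V) :
    kd T j f v = ∑ i : Fin (j + 1), (-1) ^ (i : ℕ) • T (v i) (f (i.removeNth v)) := by
  simp [kd, alternatizeUncurryFin_apply]

theorem kd_kd (T : V →ₗ[ℂ] Module.End ℂ M) (hT : ∀ v w m, T v (T w m) = T w (T v m)) {j : ℕ}
    (f : V [⋀^Fin j]→ₗ[ℂ] M) : kd T (j + 1) (kd T j f) = 0 := by
  have h := alternatizeUncurryFin_alternatizeUncurryFinLM_comp_of_symmetric
    (f := LinearMap.mk₂ ℂ (fun v w : V => ((T v) ∘ₗ (T w)).compAlternatingMap f)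
      (fun f g v => by ext; simp) (fun c f v => by ext; simp)
      (fun f v w => by ext; simp) (fun c f v => by ext; simp))
    (fun v w => by ext m; simp [hT v w])
  rw [← h]
  ext v
  simp [kd_apply, alternatizeUncurryFin_apply, map_sum]

/-- Transport of forms along a linear map of values and a linear map of arguments. -/
theorem kd_transport (T : V →ₗ[ℂ] Module.End ℂ M) (T' : V →ₗ[ℂ] Module.End ℂ M')
    (φ : M →ₗ[ℂ] M') (s : V →ₗ[ℂ] V) (h : ∀ v m, T' v (φ m) = φ (T (s v) m)) {j : ℕ}
    (f : V [⋀^Fin j]→ₗ[ℂ] M) :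
    kd T' j (φ.compAlternatingMap (f.compLinearMap s)) =
      φ.compAlternatingMap ((kd T j f).compLinearMap s) := by
  ext v
  simp only [kd_apply, LinearMap.compAlternatingMap_apply, compLinearMap_apply, h, map_sum,
    map_zsmul]
  rfl

theorem kd_natural (T : V →ₗ[ℂ] Module.End ℂ M) (T' : V →ₗ[ℂ] Module.End ℂ M')
    (φ : M →ₗ[ℂ] M') (h : ∀ v m, T' v (φ m) = φ (T v m)) {j : ℕ} (f : V [⋀^Fin j]→ₗ[ℂ] M) :
    kd T' j (φ.compAlternatingMap f) = φ.compAlternatingMap (kd T j f) :=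
  kd_transport T T' φ LinearMap.id h f

/-- The coboundaries of the Koszul complex. -/
def cobd (T : V →ₗ[ℂ] Module.End ℂ M) : (j : ℕ) → Submodule ℂ (V [⋀^Fin j]→ₗ[ℂ] M)
  | 0 => ⊥
  | j + 1 => LinearMap.range (kd T j)

theorem cobd_transport (T : V →ₗ[ℂ] Module.End ℂ M) (T' : V →ₗ[ℂ] Module.End ℂ M')
    (φ : M →ₗ[ℂ] M') (s : V →ₗ[ℂ] V) (h : ∀ v m, T' v (φ m) = φ (T (s v) m)) {j : ℕ}
    {f : V [⋀^Fin j]→ₗ[ℂ] M} (hf : f ∈ cobd T j) :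
    φ.compAlternatingMap (f.compLinearMap s) ∈ cobd T' j := by
  cases j with
  | zero =>
    rw [(Submodule.mem_bot ℂ).1 hf]
    refine (Submodule.mem_bot ℂ).2 ?_
    ext; simp
  | succ j =>
    obtain ⟨u, rfl⟩ := hf
    exact ⟨_, kd_transport T T' φ s h u⟩

theorem cobd_natural (T : V →ₗ[ℂ] Module.End ℂ M) (T' : V →ₗ[ℂ] Module.End ℂ M')
    (φ : M →ₗ[ℂ] M') (h : ∀ v m, T' v (φ m) = φ (T v m)) {j : ℕ}
    {f : V [⋀^Fin j]→ₗ[ℂ] M} (hf : f ∈ cobd T j) : φ.compAlternatingMap f ∈ cobd T' j :=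
  cobd_transport T T' φ LinearMap.id h hf

/-- The derivation of the algebra of forms extending `Q : V → V`. -/
def formDer (M : Type) [AddCommGroup M] [Module ℂ M] (Q : V →ₗ[ℂ] V) :
    (j : ℕ) → Module.End ℂ (V [⋀^Fin j]→ₗ[ℂ] M)
  | 0 => 0
  | _ + 1 => alternatizeUncurryFinLM ∘ₗ (LinearMap.lcomp ℂ _ Q) ∘ₗ curryLeftLinearMap

theorem formDer_succ_apply (Q : V →ₗ[ℂ] V) {j : ℕ} (f : V [⋀^Fin (j + 1)]→ₗ[ℂ] M)
    (v : Fin (j + 1) → V) : formDer M Q (j + 1) f v =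
      ∑ i : Fin (j + 1), (-1) ^ (i : ℕ) • f (Matrix.vecCons (Q (v i)) (i.removeNth v)) := by
  simp [formDer, alternatizeUncurryFin_apply]

theorem formDer_apply_of_eigen (Q : V →ₗ[ℂ] V) {j : ℕ} (f : V [⋀^Fin j]→ₗ[ℂ] M)
    (v : Fin j → V) (q : Fin j → ℂ) (h : ∀ i, Q (v i) = q i • v i) :
    formDer M Q j f v = (∑ i, q i) • f v := by
  cases j with
  | zero => simp [formDer]
  | succ j =>
    rw [formDer_succ_apply, Finset.sum_smul]
    refine Finset.sum_congr rfl fun i _ => ?_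
    have h1 : f (Matrix.vecCons (q i • v i) (i.removeNth v))
        = q i • f (Matrix.vecCons (v i) (i.removeNth v)) :=
      f.toMultilinearMap.cons_smul (i.removeNth v) (q i) (v i)
    rw [h, h1, smul_comm, ← neg_one_pow_smul_map_insertNth, smul_smul, ← pow_add,
      Even.neg_one_pow ⟨_, rfl⟩, one_smul, Fin.insertNth_self_removeNth]

section Homotopy

variable {κ : Type} [Fintype κ] (T : V →ₗ[ℂ] Module.End ℂ M) (S : κ → Module.End ℂ M) (u : κ → V)

/-- The Koszul homotopy attached to operators `S k` and vectors `u k`. -/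
def kh (j : ℕ) : (V [⋀^Fin (j + 1)]→ₗ[ℂ] M) →ₗ[ℂ] (V [⋀^Fin j]→ₗ[ℂ] M) where
  toFun f := ∑ k, (S k).compAlternatingMap (f.curryLeft (u k))
  map_add' f g := by
    rw [← Finset.sum_add_distrib]
    exact Finset.sum_congr rfl fun k _ => by ext; simp
  map_smul' c f := by
    rw [Finset.smul_sum]
    exact Finset.sum_congr rfl fun k _ => by ext; simp

theorem kh_apply {j : ℕ} (f : V [⋀^Fin (j + 1)]→ₗ[ℂ] M) (v : Fin j → V) :
    kh S u j f v = ∑ k, S k (f (Matrix.vecCons (u k) v)) := by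
  simp [kh, alternatingMap_sum_apply]

/-- The Laplacian of the Koszul complex. -/
def lap (N : Module.End ℂ M) (Q : V →ₗ[ℂ] V) (j : ℕ) : Module.End ℂ (V [⋀^Fin j]→ₗ[ℂ] M) :=
  N.compAlternatingMapₗ ℂ + formDer M Q j

theorem lap_apply_of_eigen (N : Module.End ℂ M) (Q : V →ₗ[ℂ] V) {j : ℕ} (f : V [⋀^Fin j]→ₗ[ℂ] M)
    (v : Fin j → V) (q : Fin j → ℂ) (h : ∀ i, Q (v i) = q i • v i) :
    lap N Q j f v = N (f v) + (∑ i, q i) • f v := by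
  simp [lap, formDer_apply_of_eigen Q f v q h]

variable {T S u} {N : Module.End ℂ M} {Q : V →ₗ[ℂ] V}

theorem kh_kd_zero (hN : ∀ m, N m = ∑ k, S k (T (u k) m)) (f : V [⋀^Fin 0]→ₗ[ℂ] M) :
    kh S u 0 (kd T 0 f) = lap N Q 0 f := by
  ext v
  simp [kh_apply, kd_apply, lap, formDer, hN, Matrix.vecCons]

theorem kd_kh_add (θ : κ → V →ₗ[ℂ] ℂ) (hS : ∀ k v m, T v (S k m) = S k (T v m) + θ k v • m)
    (hN : ∀ m, N m = ∑ k, S k (T (u k) m)) (hQ : ∀ v, Q v = ∑ k, θ k v • u k) {j : ℕ}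
    (f : V [⋀^Fin (j + 1)]→ₗ[ℂ] M) :
    kd T j (kh S u j f) + kh S u (j + 1) (kd T (j + 1) f) = lap N Q (j + 1) f := by
  ext v
  have h1 : ∀ k, kd T (j + 1) f (Matrix.vecCons (u k) v) = T (u k) (f v) -
      ∑ i : Fin (j + 1), (-1) ^ (i : ℕ) • T (v i) (f (Matrix.vecCons (u k) (i.removeNth v))) := by
    intro k
    rw [kd_apply, Fin.sum_univ_succ, sub_eq_add_neg, ← Finset.sum_neg_distrib]
    congr 1
    · simp
    · refine Finset.sum_congr rfl fun i _ => ?_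
      rw [← neg_smul]
      congr 1
      · simp [pow_succ]
      · congr 2
        ext a
        refine Fin.cases ?_ (fun b => ?_) a <;> simp [Fin.removeNth]
  have h2 : ∀ i : Fin (j + 1), f (Matrix.vecCons (Q (v i)) (i.removeNth v)) =
      ∑ k, θ k (v i) • f (Matrix.vecCons (u k) (i.removeNth v)) := by
    intro i
    have := congrArg (fun g : V [⋀^Fin j]→ₗ[ℂ] M => g (i.removeNth v))
      (show f.curryLeft (Q (v i)) = ∑ k, θ k (v i) • f.curryLeft (u k) by
        rw [hQ, map_sum]; simp)
    simpa [alternatingMap_sum_apply] using this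
  simp only [AlternatingMap.add_apply, kh_apply, h1, lap, LinearMap.add_apply,
    formDer_succ_apply, h2, LinearMap.compAlternatingMapₗ_apply,
    LinearMap.compAlternatingMap_apply, hN]
  rw [kd_apply]
  simp only [kh_apply, map_sum, hS, Finset.sum_add_distrib, map_sub, Finset.sum_sub_distrib,
    smul_add, Finset.smul_sum, map_zsmul]
  rw [Finset.sum_comm (s := (Finset.univ : Finset κ))]
  abel_nf

end Homotopy

end Koszul

section Polynomials

open Polynomial

variable {M M' : Type} [AddCommGroup M] [Module ℂ M] [AddCommGroup M'] [Module ℂ M']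

theorem aeval_intertwine (L : Module.End ℂ M) (L' : Module.End ℂ M') (φ : M →ₗ[ℂ] M')
    (h : ∀ x, φ (L x) = L' (φ x)) (p : ℂ[X]) (x : M) :
    φ (aeval L p x) = aeval L' p (φ x) := by
  induction p using Polynomial.induction_on' generalizing x with
  | add p q hp hq => simp [hp, hq]
  | monomial n a =>
    simp only [aeval_monomial, Module.algebraMap_end_eq_smul_id, Module.End.mul_apply,
      LinearMap.smul_apply, LinearMap.id_apply, _root_.map_smul]
    congr 1
    induction n generalizing x with
    | zero => simp
    | succ n ih => rw [pow_succ, pow_succ, Module.End.mul_apply, Module.End.mul_apply, ih, h]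

/-- If `0` is at most a simple root of a polynomial annihilating `f`, then `f` is the sum of
an element of the kernel and an element of the range. -/
theorem exists_ker_add_range {q : ℂ[X]} (hq : q.coeff 0 ≠ 0) :
    ∃ α β : ℂ[X], ∀ {M : Type} [AddCommGroup M] [Module ℂ M] (L : Module.End ℂ M) (f : M),
      aeval L (X * q) f = 0 → f = aeval L α f + L (aeval L β f) ∧ L (aeval L α f) = 0 := by
  refine ⟨C (q.coeff 0)⁻¹ * q, -(C (q.coeff 0)⁻¹ * q.divX), fun L f hf => ⟨?_, ?_⟩⟩
  · have h1 : (1 : ℂ[X]) = C (q.coeff 0)⁻¹ * q + X * -(C (q.coeff 0)⁻¹ * q.divX) := by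
      have h2 : C (q.coeff 0)⁻¹ * C (q.coeff 0) = 1 := by
        rw [← C_mul, inv_mul_cancel₀ hq, C_1]
      linear_combination C (q.coeff 0)⁻¹ * divX_mul_X_add q - h2
    conv_lhs => rw [← Module.End.one_apply (R := ℂ) f, ← map_one (aeval (R := ℂ) L), h1]
    simp
  · have : X * (C (q.coeff 0)⁻¹ * q) = C (q.coeff 0)⁻¹ * (X * q) := by ring
    have h2 := congrArg (fun p => aeval L p f) this
    simp only [map_mul, aeval_X, Module.End.mul_apply] at h2 hf ⊢
    rw [h2, hf, map_zero]

theorem eq_zero_of_sq_apply_eq_zero {q : ℂ[X]} (hq : q.coeff 0 ≠ 0) (L : Module.End ℂ M) (f : M)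
    (h : aeval L (X * q) f = 0) (h2 : L (L f) = 0) : L f = 0 := by
  obtain ⟨α, β, hab⟩ := exists_ker_add_range hq
  obtain ⟨h3, h4⟩ := hab L f h
  have h5 : L (aeval L β f) = aeval L β (L f) := aeval_intertwine L L L (fun _ => rfl) β f
  have h6 : L (aeval L β (L f)) = aeval L β (L (L f)) :=
    aeval_intertwine L L L (fun _ => rfl) β (L f)
  rw [h3, map_add, h4, zero_add, h5, h6, h2, map_zero]

/-- The polynomial `X (X - 1) ⋯ (X - (K - 1))`. -/
def fallPoly (K : ℕ) : ℂ[X] := ∏ m ∈ Finset.range K, (X - C (m : ℂ))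

theorem fallPoly_succ (K : ℕ) :
    ∃ q : ℂ[X], fallPoly (K + 1) = X * q ∧ q.coeff 0 ≠ 0 := by
  refine ⟨∏ m ∈ Finset.range K, (X - C ((m + 1 : ℕ) : ℂ)), ?_, ?_⟩
  · rw [fallPoly, Finset.prod_range_succ', mul_comm]
    simp
  · rw [coeff_zero_eq_eval_zero, eval_prod]
    refine Finset.prod_ne_zero_iff.2 fun m _ => ?_
    simp only [eval_sub, eval_X, eval_C, zero_sub]
    exact neg_ne_zero.2 (Nat.cast_ne_zero.2 (Nat.succ_ne_zero m))

variable {F : ℕ → Submodule ℂ M} {N : Module.End ℂ M} {k : ℕ}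

theorem aeval_fallPoly_eq_zero (h0 : ∀ x ∈ F 0, N x = (k : ℂ) • x)
    (hF : ∀ d, ∀ x ∈ F (d + 1), N x - ((k + (d + 1) : ℕ) : ℂ) • x ∈ F d) {K d : ℕ} {x : M}
    (hx : x ∈ F d) (hK : d + k < K) : aeval N (fallPoly K) x = 0 := by
  induction K generalizing d x with
  | zero => omega
  | succ K ih =>
    have e : fallPoly (K + 1) = fallPoly K * (X - C (K : ℂ)) := Finset.prod_range_succ _ _
    rcases Nat.lt_succ_iff_lt_or_eq.1 hK with h | h
    · rw [e, mul_comm, map_mul, Module.End.mul_apply, ih hx h, map_zero]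
    · rw [e, map_mul, Module.End.mul_apply]
      have e2 : aeval N (X - C (K : ℂ)) x = N x - (K : ℂ) • x := by
        simp [Nat.cast_smul_eq_nsmul]
      rw [e2]
      cases d with
      | zero => rw [h0 x hx, ← h, zero_add, sub_self, map_zero]
      | succ d =>
        refine ih (d := d) ?_ (by omega)
        have := hF d x hx
        rwa [← h, add_comm (d + 1) k]

theorem mem_zero_of_apply_eq_zero
    (hF : ∀ d, ∀ x ∈ F (d + 1), N x - ((k + (d + 1) : ℕ) : ℂ) • x ∈ F d) {d : ℕ} {x : M}
    (hx : x ∈ F d) (hN : N x = 0) : x ∈ F 0 := by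
  induction d with
  | zero => exact hx
  | succ d ih =>
    have := hF d x hx
    rw [hN, zero_sub, Submodule.neg_mem_iff] at this
    exact ih ((Submodule.smul_mem_iff _ (Nat.cast_ne_zero.2 (by omega))).1 this)

theorem apply_bijective_of_filtration (hk : k ≠ 0) (hF' : ∀ x, ∃ d, x ∈ F d)
    (h0 : ∀ x ∈ F 0, N x = (k : ℂ) • x)
    (hF : ∀ d, ∀ x ∈ F (d + 1), N x - ((k + (d + 1) : ℕ) : ℂ) • x ∈ F d) :
    Function.Bijective N := by
  have hk' : (k : ℂ) ≠ 0 := Nat.cast_ne_zero.2 hk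
  constructor
  · rw [injective_iff_map_eq_zero]
    intro x hx
    obtain ⟨d, hd⟩ := hF' x
    have h1 := h0 x (mem_zero_of_apply_eq_zero hF hd hx)
    rw [hx] at h1
    exact (smul_eq_zero.1 h1.symm).resolve_left hk'
  · intro x
    obtain ⟨d, hd⟩ := hF' x
    induction d generalizing x with
    | zero => exact ⟨(k : ℂ)⁻¹ • x, by rw [_root_.map_smul, h0 x hd, inv_smul_smul₀ hk']⟩
    | succ d ih =>
      have hk2 : ((k + (d + 1) : ℕ) : ℂ) ≠ 0 := Nat.cast_ne_zero.2 (by omega)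
      obtain ⟨y, hy⟩ := ih _ (hF d x hd)
      refine ⟨((k + (d + 1) : ℕ) : ℂ)⁻¹ • (x - y), ?_⟩
      rw [_root_.map_smul, map_sub, hy, sub_sub_cancel, inv_smul_smul₀ hk2]

end Polynomials

section Weyl

/-- A presentation of `A` as a quotient of the Weyl algebra of a symplectic vector space. -/
structure WeylGen (V A : Type) [AddCommGroup V] [Module ℂ V] [Ring A] [Algebra ℂ A] where
  /-- The generators. -/
  gen : V →ₗ[ℂ] A
  /-- The symplectic form. -/
  form : V →ₗ[ℂ] V →ₗ[ℂ] ℂ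
  comm : ∀ v w, gen v * gen w = gen w * gen v + algebraMap ℂ A (form v w)
  nondeg : ∀ v, (∀ w, form w v = 0) → v = 0
  adjoin : Algebra.adjoin ℂ (Set.range gen) = ⊤

variable {V A : Type} [AddCommGroup V] [Module ℂ V] [Ring A] [Algebra ℂ A] (W : WeylGen V A)

namespace WeylGen

/-- The filtration by degree, shifted by one. -/
def fil : ℕ → Submodule ℂ A
  | 0 => ⊥
  | d + 1 => (1 ⊔ LinearMap.range W.gen) ^ d

theorem fil_succ_succ (d : ℕ) :
    W.fil (d + 2) = (1 ⊔ LinearMap.range W.gen) * W.fil (d + 1) := by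
  rw [fil, fil, pow_succ']

theorem fil_le_succ (d : ℕ) : W.fil d ≤ W.fil (d + 1) := by
  cases d with
  | zero => exact bot_le
  | succ d =>
    rw [fil_succ_succ]
    intro a ha
    rw [← one_mul a]
    exact Submodule.mul_mem_mul (Submodule.mem_sup_left (Submodule.one_le.1 le_rfl)) ha

theorem fil_mono : Monotone W.fil := monotone_nat_of_le_succ W.fil_le_succ

theorem gen_mul_mem {d : ℕ} {a : A} (v : V) (ha : a ∈ W.fil d) : W.gen v * a ∈ W.fil (d + 1) := by
  cases d with
  | zero => rw [(Submodule.mem_bot ℂ).1 ha, mul_zero]; exact Submodule.zero_mem _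
  | succ d =>
    rw [fil_succ_succ]
    exact Submodule.mul_mem_mul (Submodule.mem_sup_right ⟨v, rfl⟩) ha

theorem fil_induction {p : (d : ℕ) → A → Prop} (h1 : p 0 1)
    (hmono : ∀ d a, a ∈ W.fil (d + 1) → p d a → p (d + 1) a)
    (hgen : ∀ d v a, a ∈ W.fil (d + 1) → p d a → p (d + 1) (W.gen v * a))
    (hadd : ∀ d a b, p d a → p d b → p d (a + b)) (hsmul : ∀ d (c : ℂ) a, p d a → p d (c • a))
    (d : ℕ) (a : A) (ha : a ∈ W.fil (d + 1)) : p d a := by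
  induction d generalizing a with
  | zero =>
    obtain ⟨c, rfl⟩ := Submodule.mem_one.1 (by simpa [fil] using ha)
    rw [Algebra.algebraMap_eq_smul_one]
    exact hsmul _ _ _ h1
  | succ d ih =>
    rw [fil_succ_succ] at ha
    induction ha using Submodule.mul_induction_on' with
    | mem_mul_mem x hx y hy =>
      obtain ⟨r, hr, s, ⟨v, rfl⟩, rfl⟩ := Submodule.mem_sup.1 hx
      obtain ⟨c, rfl⟩ := Submodule.mem_one.1 hr
      rw [add_mul, ← Algebra.smul_def]
      exact hadd _ _ _ (hsmul _ _ _ (hmono _ _ hy (ih _ hy))) (hgen _ _ _ hy (ih _ hy))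
    | add x hx y hy h h' => exact hadd _ _ _ h h'

theorem exists_mem_fil (a : A) : ∃ d, a ∈ W.fil (d + 1) := by
  have ha : a ∈ Algebra.adjoin ℂ (Set.range W.gen) := W.adjoin ▸ Algebra.mem_top
  have hle : ∀ d d' a, a ∈ W.fil (d + 1) → a ∈ W.fil (d + d' + 1) := fun d d' a h =>
    W.fil_mono (by omega) h
  induction ha using Algebra.adjoin_induction with
  | mem x hx =>
    obtain ⟨v, rfl⟩ := hx
    refine ⟨1, ?_⟩
    rw [← mul_one (W.gen v)]
    exact W.gen_mul_mem v (Submodule.one_le.1 (pow_zero _).ge)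
  | algebraMap r => exact ⟨0, by simp [fil]⟩
  | add x y _ _ h h' =>
    obtain ⟨d, h⟩ := h
    obtain ⟨d', h'⟩ := h'
    exact ⟨d + d', Submodule.add_mem _ (hle _ _ _ h) (add_comm d d' ▸ hle _ _ _ h')⟩
  | mul x y _ _ h h' =>
    obtain ⟨d, h⟩ := h
    obtain ⟨d', h'⟩ := h'
    refine ⟨d + d', ?_⟩
    rw [fil] at h h' ⊢
    rw [pow_add]
    exact Submodule.mul_mem_mul h h'

/-- The inner derivation of a generator. -/
def ad : V →ₗ[ℂ] Module.End ℂ A :=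
  (LinearMap.mul ℂ A) ∘ₗ W.gen - (LinearMap.mul ℂ A).flip ∘ₗ W.gen

theorem ad_apply (v : V) (a : A) : W.ad v a = W.gen v * a - a * W.gen v := rfl

theorem ad_gen_mul (y v : V) (a : A) :
    W.ad y (W.gen v * a) = W.form y v • a + W.gen v * W.ad y a := by
  rw [ad_apply, ad_apply, ← mul_assoc, W.comm, Algebra.smul_def]
  noncomm_ring

theorem ad_mem {d : ℕ} {a : A} (y : V) (ha : a ∈ W.fil (d + 1)) : W.ad y a ∈ W.fil d := by
  revert y
  refine W.fil_induction (p := fun d a => ∀ y, W.ad y a ∈ W.fil d) ?_ ?_ ?_ ?_ ?_ d a ha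
  · intro y
    simp [ad_apply, fil]
  · exact fun d a _ h y => W.fil_le_succ _ (h y)
  · intro d v a ha h y
    rw [ad_gen_mul]
    exact Submodule.add_mem _ (Submodule.smul_mem _ _ ha) (W.gen_mul_mem v (h y))
  · intro d a b h h' y
    rw [map_add]
    exact Submodule.add_mem _ (h y) (h' y)
  · intro d c a h y
    rw [map_smul]
    exact Submodule.smul_mem _ _ (h y)

theorem euler_mem {κ : Type} [Fintype κ] (ξ y : κ → V) (h : ∀ v, ∑ k, W.form (y k) v • ξ k = v)
    {d : ℕ} {a : A} (ha : a ∈ W.fil (d + 1)) :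
    ∑ k, W.gen (ξ k) * W.ad (y k) a - (d : ℂ) • a ∈ W.fil d := by
  refine W.fil_induction (p := fun d a => ∑ k, W.gen (ξ k) * W.ad (y k) a - (d : ℂ) • a ∈ W.fil d)
    ?_ ?_ ?_ ?_ ?_ d a ha
  · simp [ad_apply]
  · intro d a ha h
    have : ∑ k, W.gen (ξ k) * W.ad (y k) a - ((d + 1 : ℕ) : ℂ) • a =
      (∑ k, W.gen (ξ k) * W.ad (y k) a - (d : ℂ) • a) - a := by
      push_cast; rw [add_smul, one_smul]; abel
    rw [this]
    exact Submodule.sub_mem _ (W.fil_le_succ _ h) ha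
  · intro d v a ha h'
    have e1 : ∀ k, W.gen (ξ k) * W.ad (y k) (W.gen v * a) = W.gen (W.form (y k) v • ξ k) * a +
        W.gen v * (W.gen (ξ k) * W.ad (y k) a) + W.form (ξ k) v • W.ad (y k) a := by
      intro k
      rw [ad_gen_mul, mul_add, ← mul_assoc _ (W.gen v), W.comm, _root_.map_smul,
        Algebra.smul_def (W.form (ξ k) v)]
      simp only [mul_smul_comm, smul_mul_assoc, add_mul, mul_assoc]
      abel
    have e2 : ∑ k, W.gen (ξ k) * W.ad (y k) (W.gen v * a) - ((d + 1 : ℕ) : ℂ) • (W.gen v * a) =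
        W.gen v * (∑ k, W.gen (ξ k) * W.ad (y k) a - (d : ℂ) • a) +
          ∑ k, W.form (ξ k) v • W.ad (y k) a := by
      simp only [e1, Finset.sum_add_distrib]
      rw [← Finset.sum_mul, ← map_sum, h, ← Finset.mul_sum, mul_sub]
      push_cast
      rw [add_smul, one_smul, mul_smul_comm]
      abel
    rw [e2]
    exact Submodule.add_mem _ (W.gen_mul_mem v h')
      (Submodule.sum_mem _ fun k _ => Submodule.smul_mem _ _ (W.fil_le_succ _ (W.ad_mem _ ha)))
  · intro d a b h h'
    convert Submodule.add_mem _ h h' using 1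
    simp only [map_add, mul_add, Finset.sum_add_distrib, smul_add]
    abel
  · intro d c a h
    convert Submodule.smul_mem _ c h using 1
    simp only [map_smul, mul_smul_comm, smul_sub, Finset.smul_sum]
    rw [smul_comm c]

end WeylGen

end Weyl

section Local

theorem exists_adapted_basis {V : Type} [AddCommGroup V] [Module ℂ V] [FiniteDimensional ℂ V]
    {P : V →ₗ[ℂ] V} (hP : IsIdempotentElem P) :
    ∃ b : Module.Basis (Fin (Module.finrank ℂ (LinearMap.range P)) ⊕
      Fin (Module.finrank ℂ (LinearMap.ker P))) ℂ V,
      (∀ i, P (b (Sum.inl i)) = b (Sum.inl i)) ∧ (∀ i, P (b (Sum.inr i)) = 0) := by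
  refine ⟨((Module.finBasis ℂ _).prod (Module.finBasis ℂ _)).map
    (Submodule.prodEquivOfIsCompl _ _ (LinearMap.IsIdempotentElem.isCompl hP)), fun i => ?_, fun i => ?_⟩
  · simp only [Module.Basis.map_apply, Module.Basis.prod_apply, Sum.elim_inl, Function.comp_apply,
      LinearMap.inl_apply, Submodule.coe_prodEquivOfIsCompl', ZeroMemClass.coe_zero, add_zero]
    exact (LinearMap.IsIdempotentElem.mem_range_iff hP).1 (Subtype.property _)
  · simp

variable {V A : Type} [AddCommGroup V] [Module ℂ V] [Ring A] [Algebra ℂ A] (W : WeylGen V A)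

namespace WeylGen

theorem form_swap (v w : V) (hA : Function.Injective (algebraMap ℂ A)) :
    W.form v w = - W.form w v := by
  apply hA
  have h1 := W.comm v w
  have h2 := W.comm w v
  rw [h2, add_assoc] at h1
  have h3 := left_eq_add.1 h1
  rw [map_neg, eq_neg_of_add_eq_zero_right h3]

theorem exists_dual_basis [FiniteDimensional ℂ V] {ι : Type} (b : Module.Basis ι ℂ V) :
    ∃ w : ι → V, ∀ i v, W.form v (w i) = b.coord i v := by
  have hinj : Function.Injective W.form.flip := by
    rw [injective_iff_map_eq_zero]
    exact fun v hv => W.nondeg v fun w => LinearMap.congr_fun hv w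
  have hsurj : Function.Surjective W.form.flip :=
    (LinearMap.injective_iff_surjective_of_finrank_eq_finrank
      Subspace.dual_finrank_eq.symm).1 hinj
  choose w hw using fun i => hsurj (b.coord i)
  exact ⟨w, fun i v => LinearMap.congr_fun (hw i) v⟩

/-- The twisted commutator `a ↦ v a - a g(v)`. -/
def tw (g : V →ₗ[ℂ] V) : V →ₗ[ℂ] Module.End ℂ A :=
  (LinearMap.mul ℂ A) ∘ₗ W.gen - (LinearMap.mul ℂ A).flip ∘ₗ W.gen ∘ₗ g

theorem tw_apply (g : V →ₗ[ℂ] V) (v : V) (a : A) :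
    W.tw g v a = W.gen v * a - a * W.gen (g v) := rfl

theorem tw_comm (g : V →ₗ[ℂ] V) (hg : ∀ v w, W.form (g v) (g w) = W.form v w) (v w : V) (a : A) :
    W.tw g v (W.tw g w a) = W.tw g w (W.tw g v a) := by
  have h1 := W.comm v w
  have h2 := W.comm (g v) (g w)
  rw [hg] at h2
  have h3 := Algebra.commutes (W.form v w) a
  rw [← sub_eq_zero] at h1 h2 h3 ⊢
  simp only [tw_apply]
  refine Eq.trans (b := (W.gen v * W.gen w - (W.gen w * W.gen v + algebraMap ℂ A (W.form v w))) * a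
    - a * (W.gen (g v) * W.gen (g w) -
      (W.gen (g w) * W.gen (g v) + algebraMap ℂ A (W.form v w))) +
    (algebraMap ℂ A (W.form v w) * a - a * algebraMap ℂ A (W.form v w)))
    (by noncomm_ring) (by rw [h1, h2, h3]; simp)

theorem tw_mul_gen (g : V →ₗ[ℂ] V) (v w : V) (a : A) :
    W.tw g v (W.gen w * a) = W.gen w * W.tw g v a + W.form v w • a := by
  have h1 := W.comm v w
  rw [Algebra.smul_def]
  simp only [tw_apply]
  rw [mul_sub, ← mul_assoc, h1]
  noncomm_ring

theorem tw_ad (g : V →ₗ[ℂ] V) (v w : V) (a : A) :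
    W.tw g v (W.ad w a) = W.ad w (W.tw g v a) + W.form (v - g v) w • a := by
  have h1 := W.comm v w
  have h2 := W.comm (g v) w
  have h3 := Algebra.commutes (W.form (g v) w) a
  rw [Algebra.smul_def, map_sub, LinearMap.sub_apply, map_sub]
  rw [← sub_eq_zero] at h1 h2 h3 ⊢
  simp only [tw_apply, ad_apply]
  refine Eq.trans (b := (W.gen v * W.gen w - (W.gen w * W.gen v + algebraMap ℂ A (W.form v w))) * a
    - a * (W.gen (g v) * W.gen w -
      (W.gen w * W.gen (g v) + algebraMap ℂ A (W.form (g v) w))) +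
    (algebraMap ℂ A (W.form (g v) w) * a - a * algebraMap ℂ A (W.form (g v) w)))
    (by noncomm_ring) (by rw [h1, h2, h3]; simp)

end WeylGen

end Local

section Local

variable {V A : Type} [AddCommGroup V] [Module ℂ V] [Ring A] [Algebra ℂ A] {W : WeylGen V A}

/-- A symplectic map `g` with a projection `P` on its fixed vectors commuting with `g`, together
with a partial inverse `B` of `1 - g`. -/
structure WeylGen.Split (W : WeylGen V A) (g : V →ₗ[ℂ] V) where
  /-- The projection on the fixed vectors. -/
  P : V →ₗ[ℂ] V
  /-- The partial inverse of `1 - g`. -/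
  B : V →ₗ[ℂ] V
  form_map : ∀ v w, W.form (g v) (g w) = W.form v w
  idem : IsIdempotentElem P
  map_P : ∀ v, g (P v) = P v
  sub_B : ∀ v, B v - g (B v) = v - P v
  B_sub : ∀ v, B (v - g v) = v - P v
  form_P : ∀ v w, W.form (P v) w = W.form v (P w)

namespace WeylGen.Split

variable {g : V →ₗ[ℂ] V} (s : W.Split g)

/-- The codimension of the space of fixed vectors. -/
def codim : ℕ := Module.finrank ℂ (LinearMap.ker s.P)

variable [FiniteDimensional ℂ V]

theorem exists_homotopy (hA : Function.Injective (algebraMap ℂ A)) :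
    ∃ (h : ∀ j, (V [⋀^Fin (j + 1)]→ₗ[ℂ] A) →ₗ[ℂ] (V [⋀^Fin j]→ₗ[ℂ] A)) (N : Module.End ℂ A),
      (∀ d a, a ∈ W.fil (d + 1) → N a - ((s.codim + d : ℕ) : ℂ) • a ∈ W.fil d) ∧
      (∀ f, h 0 (kd (W.tw g) 0 f) = lap N (s.P + s.P - 1) 0 f) ∧
      (∀ j f, kd (W.tw g) j (h j f) + h (j + 1) (kd (W.tw g) (j + 1) f) =
        lap N (s.P + s.P - 1) (j + 1) f) := by
  obtain ⟨b, hb1, hb2⟩ := exists_adapted_basis s.idem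
  obtain ⟨w, hw⟩ := W.exists_dual_basis b
  let S := Sum.elim (fun i => LinearMap.mul ℂ A (W.gen (w i))) (fun i => W.ad (w i))
  let u := Sum.elim (fun i => s.P (b i)) (fun i => -s.B (b i))
  let θ := Sum.elim (fun i => W.form.flip (w i))
    (fun i => (W.form.flip (w i)) ∘ₗ (LinearMap.id - g))
  let N : Module.End ℂ A := ∑ k, S k * W.tw g (u k)
  have hexp : ∀ v, ∑ i, W.form v (w i) • b i = v := fun v => by
    simp only [hw]
    exact b.sum_repr v
  have hexp' : ∀ v, ∑ i, W.form (b i) v • w i = v := fun v => by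
    rw [← sub_eq_zero]
    refine W.nondeg _ fun z => ?_
    rw [map_sub, map_sum, sub_eq_zero]
    simp only [map_smul, smul_eq_mul]
    conv_rhs => rw [← hexp z]
    simp [mul_comm]
  have hS : ∀ k v m, W.tw g v (S k m) = S k (W.tw g v m) + θ k v • m := by
    rintro (i | i) v m
    · exact W.tw_mul_gen g v (w i) m
    · exact W.tw_ad g v (w i) m
  have hN : ∀ m, N m = ∑ k, S k (W.tw g (u k) m) := fun m => by
    simp [N, LinearMap.sum_apply]
  have hQ : ∀ v, (s.P + s.P - 1) v = ∑ k, θ k v • u k := fun v => by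
    rw [Fintype.sum_sum_type]
    simp only [θ, u, Sum.elim_inl, Sum.elim_inr, LinearMap.flip_apply,
      LinearMap.comp_apply, LinearMap.sub_apply, LinearMap.id_apply, smul_neg,
      Finset.sum_neg_distrib]
    simp only [← _root_.map_smul, ← map_sum]
    rw [hexp, hexp, s.B_sub]
    simp only [LinearMap.add_apply, Module.End.one_apply]
    abel
  refine ⟨kh S u, N, fun d a ha => ?_, fun f => kh_kd_zero hN f, fun j f => kd_kh_add θ hS hN hQ f⟩
  have e1 : ∀ i, S (Sum.inr i) (W.tw g (u (Sum.inr i)) a) = W.form (b i - s.P (b i)) (w i) • a +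
      W.gen (-(b i - s.P (b i))) * W.ad (w i) a - W.ad (w i) (W.ad (g (s.B (b i))) a) := by
    intro i
    have : W.tw g (s.B (b i)) a = W.gen (b i - s.P (b i)) * a + W.ad (g (s.B (b i))) a := by
      rw [← s.sub_B, tw_apply, ad_apply, map_sub]
      noncomm_ring
    simp only [S, u, Sum.elim_inr, map_neg, LinearMap.neg_apply, this, map_add, ad_gen_mul]
    rw [W.form_swap (w i) _ hA, neg_smul]
    simp only [neg_mul]
    abel
  have e2 : ∀ i, S (Sum.inl i) (W.tw g (u (Sum.inl i)) a) = W.gen (w i) * W.ad (s.P (b i)) a := by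
    intro i
    simp [S, u, tw_apply, ad_apply, s.map_P]
  have e3 : ∑ i, W.form (b i - s.P (b i)) (w i) = s.codim := by
    rw [Fintype.sum_sum_type]
    simp only [hb1, hb2, sub_self, map_zero, LinearMap.zero_apply, Finset.sum_const_zero, zero_add,
      sub_zero, hw]
    simp [codim]
  have e4 := W.euler_mem (Sum.elim w fun i => -(b i - s.P (b i)))
    (Sum.elim (fun i => s.P (b i)) w) (fun v => by
      rw [Fintype.sum_sum_type]
      simp only [Sum.elim_inl, Sum.elim_inr, s.form_P, hexp']
      have : ∀ i, W.form (w i) v • -(b i - s.P (b i)) = W.form v (w i) • b i -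
        s.P (W.form v (w i) • b i) := fun i => by
          rw [W.form_swap v _ hA, _root_.map_smul, neg_smul, neg_smul, smul_neg, smul_sub]
          abel
      simp only [this, Finset.sum_sub_distrib]
      rw [← map_sum, hexp]
      abel) ha
  have e5 : N a - ((s.codim + d : ℕ) : ℂ) • a = (∑ k, W.gen (Sum.elim w
      (fun i => -(b i - s.P (b i))) k) * W.ad (Sum.elim (fun i => s.P (b i)) w k) a - (d : ℂ) • a)
      - ∑ i, W.ad (w i) (W.ad (g (s.B (b i))) a) := by
    rw [hN, Fintype.sum_sum_type, Fintype.sum_sum_type (α₁ := _ ⊕ _) (α₂ := _ ⊕ _)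
      (f := fun k => W.gen _ * W.ad _ a)]
    simp only [e1, e2, Finset.sum_add_distrib, Finset.sum_sub_distrib, ← Finset.sum_smul, e3,
      Sum.elim_inl, Sum.elim_inr]
    push_cast
    rw [add_smul]
    abel
  rw [e5]
  refine Submodule.sub_mem _ e4 (Submodule.sum_mem _ fun i _ => ?_)
  cases d with
  | zero => simp [(Submodule.mem_bot ℂ).1 (W.ad_mem (g (s.B (b i))) ha)]
  | succ d => exact W.fil_le_succ _ (W.ad_mem _ (W.ad_mem _ ha))

end WeylGen.Split

end Local

section Local

open Polynomial

theorem exists_weight {r c j : ℕ} (I : Fin j → Fin r ⊕ Fin c) (hI : Function.Injective I) :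
    ∃ k : ℕ, (c : ℂ) + ∑ t, Sum.elim (fun _ => 1) (fun _ => -1) (I t) = k ∧
      (k = 0 ↔ j = c ∧ ∀ t, (I t).isRight) := by
  have h1 := Finset.card_filter_add_card_filter_not (s := Finset.univ) (fun t => (I t).isRight)
  have h2 : (Finset.univ.filter fun t => (I t).isRight).card ≤ c := by
    have : (Finset.univ.filter fun t => (I t).isRight).card ≤
        (Finset.univ.map Function.Embedding.inr : Finset (Fin r ⊕ Fin c)).card := by
      refine Finset.card_le_card_of_injOn I (fun t ht => ?_) hI.injOn
      simp only [Finset.coe_filter, Finset.mem_univ, true_and, Set.mem_ofPred_eq] at ht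
      obtain ⟨x, hx⟩ := Sum.isRight_iff.1 ht
      simp [hx]
    simpa using this
  have h3 : ∑ t, Sum.elim (fun _ => (1 : ℂ)) (fun _ => -1) (I t) =
      (Finset.univ.filter fun t => ¬ (I t).isRight).card -
        (Finset.univ.filter fun t => (I t).isRight).card := by
    rw [← Finset.sum_filter_add_sum_filter_not Finset.univ (fun t => (I t).isRight)]
    have e1 : ∀ t ∈ Finset.univ.filter (fun t => (I t).isRight),
        Sum.elim (fun _ => (1 : ℂ)) (fun _ => -1) (I t) = -1 := by
      intro t ht
      obtain ⟨x, hx⟩ := Sum.isRight_iff.1 (Finset.mem_filter.1 ht).2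
      simp [hx]
    have e2 : ∀ t ∈ Finset.univ.filter (fun t => ¬ (I t).isRight),
        Sum.elim (fun _ => (1 : ℂ)) (fun _ => -1) (I t) = 1 := by
      intro t ht
      have := (Finset.mem_filter.1 ht).2
      obtain ⟨x, hx⟩ := Sum.isLeft_iff.1 (Sum.not_isRight.1 this)
      simp [hx]
    rw [Finset.sum_congr rfl e1, Finset.sum_congr rfl e2]
    simp only [Finset.sum_const, nsmul_eq_mul]
    ring
  rw [Finset.card_univ, Fintype.card_fin] at h1
  refine ⟨(c - (Finset.univ.filter fun t => (I t).isRight).card) +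
    (Finset.univ.filter fun t => ¬ (I t).isRight).card, ?_, ?_⟩
  · rw [h3]
    push_cast [h2]
    ring
  · have h4 : (Finset.univ.filter fun t => ¬ (I t).isRight).card = 0 ↔
        ∀ t, (I t).isRight := by
      rw [Finset.card_eq_zero, Finset.filter_eq_empty_iff]
      simp
    rw [← h4]
    omega

variable {V A : Type} [AddCommGroup V] [Module ℂ V] [Ring A] [Algebra ℂ A] {W : WeylGen V A}

/-- The inclusion of scalar forms in `A`-valued forms. -/
def inc (V A : Type) [AddCommGroup V] [Module ℂ V] [Ring A] [Algebra ℂ A] (j : ℕ) :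
    (V [⋀^Fin j]→ₗ[ℂ] ℂ) →ₗ[ℂ] (V [⋀^Fin j]→ₗ[ℂ] A) :=
  (Algebra.linearMap ℂ A).compAlternatingMapₗ ℂ

theorem inc_apply {j : ℕ} (f : V [⋀^Fin j]→ₗ[ℂ] ℂ) (v : Fin j → V) :
    inc V A j f v = algebraMap ℂ A (f v) := rfl

namespace WeylGen.Split

variable {g : V →ₗ[ℂ] V} (s : W.Split g)

/-- The volume forms of the kernel of the projection `P`, in degree `codim`. -/
def vol (j : ℕ) : Submodule ℂ (V [⋀^Fin j]→ₗ[ℂ] ℂ) where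
  carrier := {f | f.compLinearMap (1 - s.P) = f ∧ (j ≠ s.codim → f = 0)}
  add_mem' {f f'} h h' := ⟨by rw [AlternatingMap.add_compLinearMap, h.1, h'.1],
    fun hj => by rw [h.2 hj, h'.2 hj, add_zero]⟩
  zero_mem' := ⟨AlternatingMap.zero_compLinearMap _, fun _ => rfl⟩
  smul_mem' c f h := ⟨by
    refine Eq.trans ?_ (congrArg (c • ·) h.1)
    ext; simp,
    fun hj => by rw [h.2 hj, smul_zero]⟩

variable [FiniteDimensional ℂ V]

theorem exists_lap_basis (N : Module.End ℂ A)
    (hN : ∀ d a, a ∈ W.fil (d + 1) → N a - ((s.codim + d : ℕ) : ℂ) • a ∈ W.fil d) :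
    ∃ (ι : Type) (_ : Finite ι) (b : Module.Basis ι ℂ V) (isR : ι → Prop),
      (∀ i, isR i → s.P (b i) = 0) ∧ (∀ i, ¬ isR i → s.P (b i) = b i) ∧
      ∀ j, ∀ I : Fin j → ι, Function.Injective I → ∃ (k : ℕ) (N' : Module.End ℂ A),
        (∀ f, lap N (s.P + s.P - 1) j f (fun t => b (I t)) = N' (f (fun t => b (I t)))) ∧
        (∀ d a, a ∈ W.fil (d + 1) → N' a - ((k + d : ℕ) : ℂ) • a ∈ W.fil d) ∧
        (k = 0 ↔ j = s.codim ∧ ∀ t, isR (I t)) := by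
  obtain ⟨b, hb1, hb2⟩ := exists_adapted_basis s.idem
  refine ⟨_, inferInstance, b, fun i => i.isRight, ?_, ?_, fun j I hI => ?_⟩
  · rintro (i | i) hi
    · simp at hi
    · exact hb2 i
  · rintro (i | i) hi
    · exact hb1 i
    · simp at hi
  · obtain ⟨k, hk, hk'⟩ := exists_weight I hI
    refine ⟨k, N + (∑ t, Sum.elim (fun _ => (1 : ℂ)) (fun _ => -1) (I t)) • 1,
      fun f => ?_, fun d a ha => ?_, hk'⟩
    · rw [lap_apply_of_eigen N _ f _ (fun t => Sum.elim (fun _ => (1 : ℂ)) (fun _ => -1) (I t))]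
      · rfl
      · intro t
        obtain (i | i) := I t <;> simp [hb1, hb2]
    · convert hN d a ha using 1
      rw [codim]
      push_cast
      rw [← hk]
      simp only [LinearMap.add_apply, LinearMap.smul_apply, Module.End.one_apply, add_smul]
      abel

theorem inc_cocycle_and_exists_and_unique (hA : Function.Injective (algebraMap ℂ A)) (j : ℕ) :
    (∀ f ∈ s.vol j, kd (W.tw g) j (inc V A j f) = 0) ∧
    (∀ f, kd (W.tw g) j f = 0 → ∃ f' ∈ s.vol j, f - inc V A j f' ∈ cobd (W.tw g) j) ∧
    (∀ f ∈ s.vol j, inc V A j f ∈ cobd (W.tw g) j → f = 0) := by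
  obtain ⟨h, N, hN, h0, hs⟩ := s.exists_homotopy hA
  obtain ⟨ι, _, b, isR, hR, hL, hlap⟩ := s.exists_lap_basis N hN
  set Q : V →ₗ[ℂ] V := s.P + s.P - 1
  have hTT := W.tw_comm g s.form_map
  have hcomm : ∀ j f, kd (W.tw g) j (lap N Q j f) = lap N Q (j + 1) (kd (W.tw g) j f) := by
    intro j f
    cases j with
    | zero =>
      rw [← h0, ← hs, kd_kd _ hTT, map_zero, add_zero]
    | succ j =>
      rw [← hs, ← hs, map_add, kd_kd _ hTT, kd_kd _ hTT, map_zero, add_zero, zero_add]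
  have hcob : ∀ j f, kd (W.tw g) j f = 0 → lap N Q j f ∈ cobd (W.tw g) j := by
    intro j f hf
    cases j with
    | zero => rw [← h0, hf, map_zero]; exact Submodule.zero_mem _
    | succ j => rw [← hs, hf, map_zero, add_zero]; exact ⟨_, rfl⟩
  have hker : ∀ j f, lap N Q j f = 0 → ∀ I : Fin j → ι, Function.Injective I →
      f (fun t => b (I t)) ∈ W.fil 1 ∧
        (¬ (j = s.codim ∧ ∀ t, isR (I t)) → f (fun t => b (I t)) = 0) := by
    intro j f hf I hI
    obtain ⟨k, N', h1, h2, h3⟩ := hlap j I hI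
    have h4 : N' (f (fun t => b (I t))) = 0 := by rw [← h1, hf]; rfl
    obtain ⟨d, hd⟩ := W.exists_mem_fil (f (fun t => b (I t)))
    have h5 := mem_zero_of_apply_eq_zero (F := fun d => W.fil (d + 1)) (k := k)
      (fun d x hx => h2 (d + 1) x hx) hd h4
    refine ⟨h5, fun hn => ?_⟩
    have h6 := h2 0 _ h5
    rw [h4, zero_sub, Submodule.neg_mem_iff] at h6
    have h7 := (Submodule.smul_mem_iff _ (Nat.cast_ne_zero.2 fun h => hn (h3.1 h))).1 h6
    exact (Submodule.mem_bot ℂ).1 h7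
  have hker0 : ∀ j f, j ≠ s.codim → lap N Q j f = 0 → f = 0 := by
    intro j f hj hf
    refine Module.Basis.ext_alternating b fun I hI => ?_
    exact (hker j f hf I hI).2 fun h => hj h.1
  have hvol : ∀ j, ∀ f ∈ s.vol j, lap N Q j (inc V A j f) = 0 := by
    intro j f hf
    refine Module.Basis.ext_alternating b fun I hI => ?_
    obtain ⟨k, N', h1, h2, h3⟩ := hlap j I hI
    rw [h1, inc_apply]
    by_cases hc : j = s.codim ∧ ∀ t, isR (I t)
    · have h4 := h2 0 (algebraMap ℂ A (f fun t => b (I t))) (by simp [fil])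
      rw [h3.2 hc] at h4
      simpa [fil] using h4
    · have : f (fun t => b (I t)) = 0 := by
        by_cases hj : j = s.codim
        · have hc' : ∃ t, ¬ isR (I t) := by
            by_contra! hcon
            exact hc ⟨hj, hcon⟩
          obtain ⟨t, ht⟩ := hc'
          rw [← hf.1, AlternatingMap.compLinearMap_apply]
          refine AlternatingMap.map_coord_zero _ t ?_
          rw [LinearMap.sub_apply, hL _ ht]
          exact sub_self _
        · rw [hf.2 hj]; rfl
      rw [this, map_zero, map_zero]
      rfl
  have hfall : ∀ j f, ∃ K, aeval (lap N Q j) (fallPoly (K + 1)) f = 0 := by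
    intro j f
    have hex : ∀ I : Fin j → ι, ∃ K, ∀ K', K ≤ K' → Function.Injective I →
        aeval (lap N Q j) (fallPoly (K' + 1)) f (fun t => b (I t)) = 0 := by
      intro I
      by_cases hI : Function.Injective I
      · obtain ⟨k, N', h1, h2, h3⟩ := hlap j I hI
        obtain ⟨d, hd⟩ := W.exists_mem_fil (f (fun t => b (I t)))
        refine ⟨d + k, fun K' hK' _ => ?_⟩
        let ev : (V [⋀^Fin j]→ₗ[ℂ] A) →ₗ[ℂ] A :=
          { toFun := fun f => f (fun t => b (I t))
            map_add' := fun _ _ => rfl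
            map_smul' := fun _ _ => rfl }
        refine (aeval_intertwine (lap N Q j) N' ev h1 _ f).trans ?_
        refine aeval_fallPoly_eq_zero (F := fun d => W.fil (d + 1)) (k := k) ?_
          (fun d x hx => h2 (d + 1) x hx) hd (by omega)
        intro x hx
        exact sub_eq_zero.1 ((Submodule.mem_bot ℂ).1 (h2 0 x hx))
      · exact ⟨0, fun _ _ h => absurd h hI⟩
    choose K hK using hex
    obtain ⟨B, hB⟩ := Set.finite_range K |>.bddAbove
    refine ⟨B, Module.Basis.ext_alternating b fun I hI => ?_⟩
    exact hK I B (hB ⟨I, rfl⟩) hI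
  refine ⟨fun f hf => ?_, fun f hf => ?_, fun f hf hf' => ?_⟩
  · by_cases hj : j = s.codim
    · refine hker0 _ _ (by omega) ?_
      rw [← hcomm, hvol j f hf, map_zero]
    · rw [hf.2 hj, map_zero, map_zero]
  · obtain ⟨K, hK⟩ := hfall j f
    obtain ⟨q, hq, hq0⟩ := fallPoly_succ K
    rw [hq] at hK
    obtain ⟨α, β, hab⟩ := exists_ker_add_range hq0
    obtain ⟨h1, h2⟩ := hab _ f hK
    obtain ⟨ℓ, hℓ⟩ := LinearMap.exists_leftInverse_of_injective (Algebra.linearMap ℂ A)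
      (LinearMap.ker_eq_bot.2 hA)
    have hℓ' : ∀ c, ℓ (algebraMap ℂ A c) = c := fun c => LinearMap.congr_fun hℓ c
    set f0 := aeval (lap N Q j) α f with hf0
    have h3 : inc V A j (ℓ.compAlternatingMap f0) = f0 := by
      refine Module.Basis.ext_alternating b fun I hI => ?_
      obtain ⟨c, hc⟩ := Submodule.mem_one.1
        (show f0 (fun t => b (I t)) ∈ (1 : Submodule ℂ A) by
          simpa [fil] using (hker j f0 h2 I hI).1)
      rw [inc_apply, LinearMap.compAlternatingMap_apply, ← hc, hℓ']
    refine ⟨ℓ.compAlternatingMap f0, ⟨?_, fun hj => ?_⟩, ?_⟩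
    · refine Module.Basis.ext_alternating b fun I hI => ?_
      by_cases hc : ∀ t, isR (I t)
      · rw [AlternatingMap.compLinearMap_apply]
        congr 1
        funext t
        rw [LinearMap.sub_apply, hR _ (hc t)]
        exact sub_zero _
      · have h4 := (hker j f0 h2 I hI).2 fun h => hc h.2
        rw [LinearMap.compAlternatingMap_apply, h4, map_zero]
        push Not at hc
        obtain ⟨t, ht⟩ := hc
        rw [AlternatingMap.compLinearMap_apply]
        refine AlternatingMap.map_coord_zero _ t ?_
        rw [LinearMap.sub_apply, hL _ ht]
        exact sub_self _
    · rw [hker0 j f0 hj h2]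
      ext
      simp
    · rw [h3, h1, add_sub_cancel_left]
      refine hcob _ _ ?_
      rw [aeval_intertwine (lap N Q j) (lap N Q (j + 1)) (kd (W.tw g) j) (hcomm j), hf, map_zero]
  · by_cases hj : j = s.codim
    · have hf0 : inc V A j f = 0 := by
        cases j with
        | zero => exact (Submodule.mem_bot ℂ).1 hf'
        | succ j =>
          obtain ⟨u, hu⟩ := hf'
          obtain ⟨K, hK⟩ := hfall j u
          obtain ⟨q, hq, hq0⟩ := fallPoly_succ K
          rw [hq] at hK
          obtain ⟨α, β, hab⟩ := exists_ker_add_range hq0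
          obtain ⟨h1, h2⟩ := hab _ u hK
          rw [hker0 j _ (by omega) h2, zero_add] at h1
          rw [h1, hcomm] at hu
          obtain ⟨K', hK'⟩ := hfall (j + 1) (kd (W.tw g) j (aeval (lap N Q j) β u))
          obtain ⟨q', hq', hq0'⟩ := fallPoly_succ K'
          rw [hq'] at hK'
          rw [← hu]
          exact eq_zero_of_sq_apply_eq_zero hq0' _ _ hK' (by rw [hu]; exact hvol _ f hf)
      ext v
      apply hA
      rw [← inc_apply, hf0]
      simp
    · exact hf.2 hj

end WeylGen.Split

end Local

section Equivariant

/-- Commuting elements of `R` indexed by `V`, together with elements indexed by a group `G`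
acting on `V` which permute them accordingly. -/
structure KoszulDatum (R V G : Type) [Ring R] [Algebra ℂ R] [AddCommGroup V] [Module ℂ V]
    [Group G] where
  /-- The commuting elements. -/
  τ : V →ₗ[ℂ] R
  /-- The group elements. -/
  γ : G →* R
  /-- The action. -/
  σ : Representation ℂ G V
  comm : ∀ v w, τ v * τ w = τ w * τ v
  γ_mul : ∀ g v, γ g * τ v = τ (σ g v) * γ g

variable {R V G : Type} [Ring R] [Algebra ℂ R] [AddCommGroup V] [Module ℂ V]
    [Group G] (K : KoszulDatum R V G)

namespace KoszulDatum

variable (M : Type) [AddCommGroup M] [Module ℂ M] [Module R M] [IsScalarTower ℂ R M]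
  (M' : Type) [AddCommGroup M'] [Module ℂ M'] [Module R M'] [IsScalarTower ℂ R M']

/-- The commuting operators on an `R`-module. -/
def op : V →ₗ[ℂ] Module.End ℂ M := (Algebra.lsmul ℂ ℂ M).toLinearMap ∘ₗ K.τ

theorem op_apply (v : V) (m : M) : K.op M v m = K.τ v • m := rfl

theorem op_comm (v w : V) (m : M) : K.op M v (K.op M w m) = K.op M w (K.op M v m) := by
  simp only [op_apply, smul_smul, K.comm v w]

/-- The invariant alternating forms. -/
def inv (j : ℕ) : Submodule ℂ (V [⋀^Fin j]→ₗ[ℂ] M) where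
  carrier := {f | ∀ g v, K.γ g • f v = f (fun i => K.σ g (v i))}
  add_mem' {f f'} h h' g v := by
    rw [AlternatingMap.add_apply, AlternatingMap.add_apply, smul_add, h g v, h' g v]
  zero_mem' g v := smul_zero _
  smul_mem' c f h g v := by
    rw [AlternatingMap.smul_apply, AlternatingMap.smul_apply, smul_comm, h g v]

variable {M M'}

theorem kd_mem_inv {j : ℕ} {f : V [⋀^Fin j]→ₗ[ℂ] M} (hf : f ∈ K.inv M j) :
    kd (K.op M) j f ∈ K.inv M (j + 1) := by
  intro g v
  simp only [kd_apply, op_apply, Finset.smul_sum]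
  refine Finset.sum_congr rfl fun i _ => ?_
  rw [smul_comm, smul_smul, K.γ_mul, mul_smul, hf g]
  rfl

theorem comp_mem_inv (φ : M →ₗ[R] M') {j : ℕ} {f : V [⋀^Fin j]→ₗ[ℂ] M} (hf : f ∈ K.inv M j) :
    (φ.restrictScalars ℂ).compAlternatingMap f ∈ K.inv M' j := by
  intro g v
  rw [LinearMap.compAlternatingMap_apply, LinearMap.restrictScalars_apply, ← map_smul, hf g v]
  rfl

variable [Fintype G]

/-- Averaging over the group. -/
def avg (j : ℕ) : (V [⋀^Fin j]→ₗ[ℂ] M) →ₗ[ℂ] (V [⋀^Fin j]→ₗ[ℂ] M) where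
  toFun f := (Fintype.card G : ℂ)⁻¹ •
    ∑ g : G, (Algebra.lsmul ℂ ℂ M (K.γ g)).compAlternatingMap (f.compLinearMap (K.σ g⁻¹))
  map_add' f f' := by
    rw [← smul_add, ← Finset.sum_add_distrib]
    congr 1
    exact Finset.sum_congr rfl fun g _ => by ext; simp
  map_smul' c f := by
    rw [RingHom.id_apply, smul_comm c]
    congr 1
    rw [Finset.smul_sum]
    exact Finset.sum_congr rfl fun g _ => by ext; simp [smul_comm c]

theorem avg_apply {j : ℕ} (f : V [⋀^Fin j]→ₗ[ℂ] M) (v : Fin j → V) :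
    K.avg j f v = (Fintype.card G : ℂ)⁻¹ • ∑ g, K.γ g • f (fun i => K.σ g⁻¹ (v i)) := by
  rw [avg, LinearMap.coe_mk, AddHom.coe_mk, AlternatingMap.smul_apply, alternatingMap_sum_apply]
  rfl

theorem avg_mem_inv {j : ℕ} (f : V [⋀^Fin j]→ₗ[ℂ] M) : K.avg j f ∈ K.inv M j := by
  intro g v
  rw [avg_apply, avg_apply, smul_comm, Finset.smul_sum]
  congr 1
  refine Fintype.sum_equiv (Equiv.mulLeft g) _ _ fun h => ?_
  rw [smul_smul, ← map_mul, Equiv.coe_mulLeft]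
  congr 3
  funext i
  rw [← Module.End.mul_apply, ← map_mul]
  congr 2
  group

theorem avg_of_mem_inv {j : ℕ} {f : V [⋀^Fin j]→ₗ[ℂ] M} (hf : f ∈ K.inv M j) : K.avg j f = f := by
  ext v
  rw [avg_apply]
  have : ∀ g, K.γ g • f (fun i => K.σ g⁻¹ (v i)) = f v := by
    intro g
    rw [hf g]
    congr 1
    funext i
    rw [← Module.End.mul_apply, ← map_mul, mul_inv_cancel, map_one, Module.End.one_apply]
  simp only [this, Finset.sum_const, Finset.card_univ]
  rw [← Nat.cast_smul_eq_nsmul ℂ, inv_smul_smul₀ (Nat.cast_ne_zero.2 Fintype.card_ne_zero)]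

theorem kd_avg {j : ℕ} (f : V [⋀^Fin j]→ₗ[ℂ] M) :
    kd (K.op M) j (K.avg j f) = K.avg (j + 1) (kd (K.op M) j f) := by
  ext v
  simp only [kd_apply, op_apply, avg_apply, Finset.smul_sum]
  rw [Finset.sum_comm]
  refine Finset.sum_congr rfl fun g _ => Finset.sum_congr rfl fun i _ => ?_
  rw [smul_comm (K.τ (v i)) ((_ : ℂ)), smul_comm _ ((_ : ℂ)), smul_comm (K.γ g)]
  congr 2
  rw [smul_smul, smul_smul, K.γ_mul, ← Module.End.mul_apply, ← map_mul, mul_inv_cancel, map_one,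
    Module.End.one_apply]
  rfl

theorem comp_avg (φ : M →ₗ[R] M') {j : ℕ} (f : V [⋀^Fin j]→ₗ[ℂ] M) :
    (φ.restrictScalars ℂ).compAlternatingMap (K.avg j f) =
      K.avg j ((φ.restrictScalars ℂ).compAlternatingMap f) := by
  ext v
  simp only [LinearMap.compAlternatingMap_apply, avg_apply, map_smul, map_sum,
    LinearMap.restrictScalars_apply]

/-- An `R`-module which corepresents invariant alternating forms. -/
structure Univ (j : ℕ) where
  /-- The underlying module. -/
  carrier : Type
  [grp : AddCommGroup carrier]
  [mod : Module ℂ carrier]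
  [modR : Module R carrier]
  [tower : IsScalarTower ℂ R carrier]
  proj : Module.Projective R carrier
  /-- The universal form. -/
  u : V [⋀^Fin j]→ₗ[ℂ] carrier
  u_mem : u ∈ K.inv carrier j
  ext : ∀ {M : Type} [AddCommGroup M] [Module R M] (φ φ' : carrier →ₗ[R] M),
    (∀ v, φ (u v) = φ' (u v)) → φ = φ'
  lift : ∀ {M : Type} [AddCommGroup M] [Module ℂ M] [Module R M] [IsScalarTower ℂ R M]
    (f : V [⋀^Fin j]→ₗ[ℂ] M), f ∈ K.inv M j → ∃ φ : carrier →ₗ[R] M, ∀ v, φ (u v) = f v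

attribute [instance] Univ.grp Univ.mod Univ.modR Univ.tower

theorem nonempty_univ [FiniteDimensional ℂ V] (j : ℕ) : Nonempty (K.Univ j) := by
  let u' : V [⋀^Fin j]→ₗ[ℂ] (R ⊗[ℂ] (⋀[ℂ]^j V)) :=
    (TensorProduct.mk ℂ R (⋀[ℂ]^j V) 1).compAlternatingMap (exteriorPower.ιMulti ℂ j)
  have hext : ∀ {M : Type} [AddCommGroup M] [Module R M]
      (φ φ' : R ⊗[ℂ] (⋀[ℂ]^j V) →ₗ[R] M), (∀ v, φ (u' v) = φ' (u' v)) → φ = φ' := by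
    intro M _ _ φ φ' h
    let _ : Module ℂ M := Module.compHom M (algebraMap ℂ R)
    have _ : IsScalarTower ℂ R M := ⟨fun c r m => by
      rw [Algebra.smul_def, mul_smul]; rfl⟩
    refine TensorProduct.AlgebraTensorModule.curry_injective ?_
    ext v
    exact h v
  have hlift : ∀ {M : Type} [AddCommGroup M] [Module ℂ M] [Module R M] [IsScalarTower ℂ R M]
      (f : V [⋀^Fin j]→ₗ[ℂ] M), ∃ φ : R ⊗[ℂ] (⋀[ℂ]^j V) →ₗ[R] M, ∀ v, φ (u' v) = f v := by
    intro M _ _ _ _ f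
    refine ⟨TensorProduct.AlgebraTensorModule.lift ((LinearMap.toSpanSingleton R _
      (exteriorPower.alternatingMapLinearEquiv f))), fun v => ?_⟩
    simp [u']
  obtain ⟨ε, hε⟩ := hlift (K.avg j u')
  have hε' : (ε.restrictScalars ℂ).compAlternatingMap u' = K.avg j u' := by
    ext v
    exact hε v
  have hidem : ∀ x, ε (ε x) = ε x := by
    refine LinearMap.congr_fun (hext (ε ∘ₗ ε) ε fun v => ?_)
    have h1 : (ε.restrictScalars ℂ).compAlternatingMap (K.avg j u') = K.avg j u' := by
      rw [K.comp_avg, hε', K.avg_of_mem_inv (K.avg_mem_inv u')]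
    rw [LinearMap.comp_apply, hε]
    exact congrArg (fun f => f v) h1
  have hrange : ∀ x : LinearMap.range ε, ε x = x := by
    rintro ⟨_, x, rfl⟩
    exact hidem x
  have hproj : Module.Projective R (LinearMap.range ε) :=
    Module.Projective.of_split (LinearMap.range ε).subtype ε.rangeRestrict
      (LinearMap.ext fun x => Subtype.ext (hrange x))
  let u : V [⋀^Fin j]→ₗ[ℂ] (LinearMap.range ε) :=
    (ε.rangeRestrict.restrictScalars ℂ).compAlternatingMap u'
  have hu : ∀ v, (u v : R ⊗[ℂ] (⋀[ℂ]^j V)) = K.avg j u' v := fun v => hε v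
  refine ⟨{ carrier := LinearMap.range ε, proj := hproj, u := u, u_mem := ?_, ext := ?_,
            lift := ?_ }⟩
  · intro g v
    refine Subtype.ext ?_
    rw [Submodule.coe_smul, hu, hu]
    exact K.avg_mem_inv u' g v
  · intro M _ _ φ φ' h
    have := hext (φ ∘ₗ ε.rangeRestrict) (φ' ∘ₗ ε.rangeRestrict) h
    refine LinearMap.ext fun x => ?_
    have hx : ε.rangeRestrict x = x := Subtype.ext (hrange x)
    rw [← hx]
    exact LinearMap.congr_fun this x
  · intro M _ _ _ _ f hf
    obtain ⟨φ, hφ⟩ := hlift f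
    have hφ' : (φ.restrictScalars ℂ).compAlternatingMap u' = f := by
      ext v
      exact hφ v
    refine ⟨φ ∘ₗ (LinearMap.range ε).subtype, fun v => ?_⟩
    have h1 := K.comp_avg φ u'
    rw [hφ', K.avg_of_mem_inv hf] at h1
    rw [LinearMap.comp_apply, Submodule.subtype_apply, hu]
    exact congrArg (fun f => f v) h1

end KoszulDatum

end Equivariant

section Equivariant

section Dual

variable (R : Type) [Ring R] [Algebra ℂ R]

/-- The linear dual of `R`, as a left `R`-module. -/
def RDual : Type := R →ₗ[ℂ] ℂ

instance : AddCommGroup (RDual R) := inferInstanceAs (AddCommGroup (R →ₗ[ℂ] ℂ))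

instance : Module ℂ (RDual R) := inferInstanceAs (Module ℂ (R →ₗ[ℂ] ℂ))

instance : FunLike (RDual R) R ℂ := inferInstanceAs (FunLike (R →ₗ[ℂ] ℂ) R ℂ)

variable {R}

@[ext]
theorem RDual.ext {m m' : RDual R} (h : ∀ r, m r = m' r) : m = m' := LinearMap.ext h

instance : Module R (RDual R) where
  smul s m := (m : R →ₗ[ℂ] ℂ) ∘ₗ LinearMap.mulRight ℂ s
  one_smul m := RDual.ext fun r => congrArg m (mul_one r)
  mul_smul s t m := RDual.ext fun r => congrArg m (mul_assoc r s t).symm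
  smul_zero _ := rfl
  smul_add _ _ _ := rfl
  add_smul s t m := RDual.ext fun r => (congrArg m (mul_add r s t)).trans
    (LinearMap.map_add (m : R →ₗ[ℂ] ℂ) _ _)
  zero_smul m := RDual.ext fun r => (congrArg m (mul_zero r)).trans
    (LinearMap.map_zero (m : R →ₗ[ℂ] ℂ))

theorem RDual.smul_apply (s : R) (m : RDual R) (r : R) : (s • m) r = m (r * s) := rfl

instance : IsScalarTower ℂ R (RDual R) where
  smul_assoc c s m := RDual.ext fun r => by
    rw [RDual.smul_apply, mul_smul_comm]
    exact LinearMap.map_smul (m : R →ₗ[ℂ] ℂ) c _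

/-- Precomposition by a linear endomorphism. -/
def RDual.pre (f : Module.End ℂ R) : Module.End ℂ (RDual R) :=
  LinearMap.lcomp ℂ ℂ f

theorem RDual.pre_apply (f : Module.End ℂ R) (m : RDual R) (r : R) :
    RDual.pre f m r = m (f r) := rfl

end Dual

variable {R V G : Type} [Ring R] [Algebra ℂ R] [AddCommGroup V] [Module ℂ V]
    [Group G] (K : KoszulDatum R V G)

namespace KoszulDatum

/-- Operators on `R` contracting the Koszul complex with coefficients in the dual of `R`. -/
structure Contraction where
  /-- The index set. -/
  κ : Type
  [fin : Fintype κ]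
  /-- The operators. -/
  s : κ → Module.End ℂ R
  /-- The vectors. -/
  u : κ → V
  /-- The dual functionals. -/
  θ : κ → V →ₗ[ℂ] ℂ
  s_mul : ∀ k r v, s k (r * K.τ v) = s k r * K.τ v + θ k v • r
  sum_smul : ∀ v, ∑ k, θ k v • u k = v
  bijective : ∀ j : ℕ, j ≠ 0 → Function.Bijective fun r => ∑ k, s k r * K.τ (u k) + (j : ℂ) • r

attribute [instance] Contraction.fin

variable {K} [Fintype G]

theorem Contraction.dual_exact (c : K.Contraction) {j : ℕ}
    {f : V [⋀^Fin (j + 1)]→ₗ[ℂ] RDual R} (hf : f ∈ K.inv (RDual R) (j + 1))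
    (hd : kd (K.op (RDual R)) (j + 1) f = 0) :
    ∃ f' ∈ K.inv (RDual R) j, kd (K.op (RDual R)) j f' = f := by
  let S : c.κ → Module.End ℂ (RDual R) := fun k => RDual.pre (c.s k)
  let N : Module.End ℂ (RDual R) := ∑ k, S k * K.op (RDual R) (c.u k)
  have hS : ∀ k v m, K.op (RDual R) v (S k m) = S k (K.op (RDual R) v m) + c.θ k v • m := by
    intro k v m
    ext r
    have := congrArg m (c.s_mul k r v)
    refine this.trans ((LinearMap.map_add (m : R →ₗ[ℂ] ℂ) _ _).trans ?_)
    rw [LinearMap.map_smul (m : R →ₗ[ℂ] ℂ)]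
    rfl
  have hN : ∀ m, N m = ∑ k, S k (K.op (RDual R) (c.u k) m) := fun m => by
    simp [N, LinearMap.sum_apply]
  have hQ : ∀ v, (LinearMap.id : V →ₗ[ℂ] V) v = ∑ k, c.θ k v • c.u k :=
    fun v => (c.sum_smul v).symm
  have hh := fun j (f : V [⋀^Fin (j + 1)]→ₗ[ℂ] RDual R) =>
    kd_kh_add (T := K.op (RDual R)) c.θ hS hN hQ f
  have hT := K.op_comm (RDual R)
  have hlap : ∀ j (f : V [⋀^Fin j]→ₗ[ℂ] RDual R),
      lap N LinearMap.id j f = (N + (j : ℂ) • 1).compAlternatingMap f := by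
    intro j f
    ext1 v
    rw [lap_apply_of_eigen N LinearMap.id f v (fun _ => 1) (fun i => by simp)]
    simp
  have hNj : ∀ j : ℕ, N + (j : ℂ) • 1 =
      RDual.pre (∑ k, LinearMap.mulRight ℂ (K.τ (c.u k)) * c.s k + (j : ℂ) • 1) := by
    intro j
    ext m r
    rw [RDual.pre_apply, LinearMap.add_apply, hN]
    simp only [LinearMap.add_apply, LinearMap.sum_apply, LinearMap.smul_apply]
    refine Eq.trans ?_ (LinearMap.map_add (m : R →ₗ[ℂ] ℂ) _ _).symm
    rw [LinearMap.map_smul (m : R →ₗ[ℂ] ℂ), _root_.map_sum (show R →ₗ[ℂ] ℂ from m)]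
    refine (LinearMap.add_apply (_ : R →ₗ[ℂ] ℂ) (_ : R →ₗ[ℂ] ℂ) r).trans ?_
    congr 1
    exact LinearMap.sum_apply _ (fun k => (S k (K.op (RDual R) (c.u k) m) : R →ₗ[ℂ] ℂ)) r
  have hbij : ∀ j : ℕ, j ≠ 0 → ∃ E : RDual R ≃ₗ[ℂ] RDual R, ∀ m, E m = (N + (j : ℂ) • 1) m := by
    intro j hj
    let E0 : R ≃ₗ[ℂ] R := LinearEquiv.ofBijective
      (∑ k, LinearMap.mulRight ℂ (K.τ (c.u k)) * c.s k + (j : ℂ) • 1) (by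
        convert c.bijective j hj using 2 with r
        simp [LinearMap.sum_apply])
    refine ⟨LinearEquiv.ofLinearMap (RDual.pre E0) (RDual.pre E0.symm) ?_ ?_, fun m => ?_⟩
    · ext m r
      exact congrArg m (E0.symm_apply_apply r)
    · ext m r
      exact congrArg m (E0.apply_symm_apply r)
    · rw [hNj]
      rfl
  have hcomm : ∀ f : V [⋀^Fin (j + 1)]→ₗ[ℂ] RDual R,
      kd (K.op (RDual R)) (j + 1) (lap N LinearMap.id (j + 1) f) =
        lap N LinearMap.id (j + 2) (kd (K.op (RDual R)) (j + 1) f) := by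
    intro f
    rw [← hh, ← hh, map_add, kd_kd _ hT, kd_kd _ hT, map_zero, add_zero, zero_add]
  obtain ⟨E1, hE1⟩ := hbij (j + 1) (by omega)
  obtain ⟨E2, hE2⟩ := hbij (j + 2) (by omega)
  have hE1' : lap N LinearMap.id (j + 1) ((E1.symm : RDual R →ₗ[ℂ] RDual R).compAlternatingMap f)
      = f := by
    rw [hlap]
    ext1 v
    exact (hE1 _).symm.trans (E1.apply_symm_apply (f v))
  have h0 : kd (K.op (RDual R)) (j + 1)
      ((E1.symm : RDual R →ₗ[ℂ] RDual R).compAlternatingMap f) = 0 := by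
    have h1 := hcomm ((E1.symm : RDual R →ₗ[ℂ] RDual R).compAlternatingMap f)
    rw [hE1', hd, hlap] at h1
    ext1 v
    have h2 := congrArg (fun f => f v) h1.symm
    exact E2.map_eq_zero_iff.1 ((hE2 _).trans h2)
  have h1 := hh j ((E1.symm : RDual R →ₗ[ℂ] RDual R).compAlternatingMap f)
  rw [h0, map_zero, add_zero, hE1'] at h1
  refine ⟨K.avg j (kh S c.u j ((E1.symm : RDual R →ₗ[ℂ] RDual R).compAlternatingMap f)),
    K.avg_mem_inv _, ?_⟩
  rw [K.kd_avg, h1, K.avg_of_mem_inv hf]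

end KoszulDatum

end Equivariant

section Equivariant

variable {R V G : Type} [Ring R] [Algebra ℂ R] [AddCommGroup V] [Module ℂ V]
    [Group G] (K : KoszulDatum R V G)

namespace KoszulDatum

/-- A module which corepresents the `G`-invariant vectors annihilated by the commuting
elements. -/
structure Aug where
  /-- The underlying module. -/
  carrier : Type
  [grp : AddCommGroup carrier]
  [modR : Module R carrier]
  /-- The generator. -/
  one : carrier
  τ_smul : ∀ v, K.τ v • one = 0
  γ_smul : ∀ g, K.γ g • one = one
  gen : ∀ n : carrier, ∃ r : R, r • one = n
  lift : ∀ {M : Type} [AddCommGroup M] [Module R M] (m : M), (∀ v, K.τ v • m = 0) →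
    (∀ g, K.γ g • m = m) → ∃ φ : carrier →ₗ[R] M, φ one = m

attribute [instance] Aug.grp Aug.modR

variable {K} (P : ∀ j, K.Univ j)

/-- The form represented by a linear map. -/
def Univ.form {j : ℕ} (U : K.Univ j) {M : Type} [AddCommGroup M] [Module ℂ M] [Module R M]
    [IsScalarTower ℂ R M] (φ : U.carrier →ₗ[R] M) : V [⋀^Fin j]→ₗ[ℂ] M :=
  (φ.restrictScalars ℂ).compAlternatingMap U.u

theorem Univ.form_mem {j : ℕ} (U : K.Univ j) {M : Type} [AddCommGroup M] [Module ℂ M]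
    [Module R M] [IsScalarTower ℂ R M] (φ : U.carrier →ₗ[R] M) : U.form φ ∈ K.inv M j :=
  K.comp_mem_inv φ U.u_mem

theorem Univ.exists_form_eq {j : ℕ} (U : K.Univ j) {M : Type} [AddCommGroup M] [Module ℂ M]
    [Module R M] [IsScalarTower ℂ R M] {f : V [⋀^Fin j]→ₗ[ℂ] M} (hf : f ∈ K.inv M j) :
    ∃ φ : U.carrier →ₗ[R] M, U.form φ = f := by
  obtain ⟨φ, hφ⟩ := U.lift f hf
  exact ⟨φ, AlternatingMap.ext hφ⟩

theorem Univ.form_injective {j : ℕ} (U : K.Univ j) {M : Type} [AddCommGroup M] [Module ℂ M]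
    [Module R M] [IsScalarTower ℂ R M] {φ φ' : U.carrier →ₗ[R] M} (h : U.form φ = U.form φ') :
    φ = φ' :=
  U.ext _ _ fun v => congrArg (fun f => f v) h

/-- The Koszul differential. -/
def diff (j : ℕ) : (P (j + 1)).carrier →ₗ[R] (P j).carrier :=
  ((P (j + 1)).lift _ (K.kd_mem_inv (P j).u_mem)).choose

theorem diff_u (j : ℕ) (v : Fin (j + 1) → V) :
    diff P j ((P (j + 1)).u v) = kd (K.op _) j (P j).u v :=
  ((P (j + 1)).lift _ (K.kd_mem_inv (P j).u_mem)).choose_spec v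

section

variable {M : Type} [AddCommGroup M] [Module ℂ M] [Module R M] [IsScalarTower ℂ R M]

theorem form_comp_diff {j : ℕ} (φ : (P j).carrier →ₗ[R] M) :
    (P (j + 1)).form (φ ∘ₗ diff P j) = kd (K.op M) j ((P j).form φ) := by
  ext v
  refine (congrArg φ (diff_u P j v)).trans ?_
  simp only [kd_apply, map_sum, map_zsmul, op_apply, map_smul]
  rfl

end

theorem diff_comp_diff (j : ℕ) : diff P j ∘ₗ diff P (j + 1) = 0 := by
  refine (P (j + 2)).form_injective ?_
  rw [form_comp_diff]
  have h : (P (j + 1)).form (diff P j) = kd (K.op _) j (P j).u :=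
    AlternatingMap.ext (diff_u P j)
  rw [h, kd_kd _ (K.op_comm _)]
  rfl

theorem exists_aug (N : K.Aug) : ∃ ε : (P 0).carrier →ₗ[R] N.carrier, (∀ v, ε ((P 0).u v) = N.one) ∧
    ε ∘ₗ diff P 0 = 0 ∧ (∀ x, ε x = 0 → ∃ y, diff P 0 y = x) ∧ Function.Surjective ε := by
  let _ : Module ℂ N.carrier := Module.compHom N.carrier (algebraMap ℂ R)
  have _ : IsScalarTower ℂ R N.carrier := ⟨fun c r m => by
    rw [Algebra.smul_def, mul_smul]; rfl⟩
  obtain ⟨ε, hε⟩ := (P 0).lift (AlternatingMap.constOfIsEmpty ℂ V (Fin 0) N.one)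
    fun g v => N.γ_smul g
  have hε1 : ∀ v, ε ((P 0).u v) = N.one := hε
  have h1 : ∀ m v, kd (K.op (P 0).carrier) 0 (P 0).u v = K.τ (v 0) • (P 0).u m := by
    intro m v
    rw [kd_apply, Fin.sum_univ_one]
    simp only [Fin.val_zero, pow_zero, one_smul, op_apply]
    congr 2
    exact Subsingleton.elim _ _
  refine ⟨ε, hε1, (P 1).ext _ _ fun v => ?_, fun x hx => ?_, fun n => ?_⟩
  · rw [LinearMap.comp_apply, diff_u, h1 0, map_smul, hε1, N.τ_smul, LinearMap.zero_apply]
  · let π := (LinearMap.range (diff P 0)).mkQ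
    have hτ : ∀ v, K.τ v • π ((P 0).u 0) = 0 := by
      intro v
      rw [← map_smul, ← h1 0 (fun _ => v), ← diff_u]
      exact (Submodule.Quotient.mk_eq_zero _).2 ⟨_, rfl⟩
    have hγ : ∀ g, K.γ g • π ((P 0).u 0) = π ((P 0).u 0) := by
      intro g
      rw [← map_smul, (P 0).u_mem g]
      congr 2
      exact Subsingleton.elim _ _
    obtain ⟨φ, hφ⟩ := N.lift _ hτ hγ
    have h2 : φ ∘ₗ ε = π := (P 0).ext _ _ fun v => by
      rw [LinearMap.comp_apply, hε1, hφ]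
      congr 2
      exact Subsingleton.elim _ _
    have h3 : π x = 0 := by
      rw [← h2, LinearMap.comp_apply, hx, map_zero]
    exact (Submodule.Quotient.mk_eq_zero _).1 h3
  · obtain ⟨r, rfl⟩ := N.gen n
    exact ⟨r • (P 0).u 0, by rw [map_smul, hε1]⟩

variable [Fintype G]

theorem exact_diff (c : K.Contraction) {j : ℕ} {x : (P (j + 1)).carrier}
    (hx : diff P j x = 0) : ∃ y, diff P (j + 1) y = x := by
  by_contra hn
  have hn' : x ∉ (LinearMap.range (diff P (j + 1))).restrictScalars ℂ := fun h => hn h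
  obtain ⟨χ, hχx, hχ⟩ := Submodule.exists_le_ker_of_notMem hn'
  let F : (P (j + 1)).carrier →ₗ[R] RDual R :=
    { toFun := fun y => χ ∘ₗ (LinearMap.toSpanSingleton R _ y).restrictScalars ℂ
      map_add' := fun y y' => RDual.ext fun r =>
        (congrArg χ (smul_add r y y')).trans (map_add χ _ _)
      map_smul' := fun s y => RDual.ext fun r => congrArg χ (mul_smul r s y).symm }
  have hF : ∀ y r, F y r = χ (r • y) := fun y r => rfl
  have hF0 : F ∘ₗ diff P (j + 1) = 0 := by
    ext y r
    exact hχ ⟨r • y, map_smul _ _ _⟩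
  have hd : kd (K.op (RDual R)) (j + 1) ((P (j + 1)).form F) = 0 := by
    rw [← form_comp_diff, hF0]
    rfl
  obtain ⟨f', hf', hf⟩ := c.dual_exact ((P (j + 1)).form_mem F) hd
  obtain ⟨φ, rfl⟩ := (P j).exists_form_eq hf'
  rw [← form_comp_diff] at hf
  have h1 := (P (j + 1)).form_injective hf
  have h2 : F x = 0 := by
    rw [← h1, LinearMap.comp_apply, hx, map_zero]
  have h3 := hF x 1
  rw [h2, one_smul] at h3
  exact hχx h3.symm

end KoszulDatum

end Equivariant

section Resolution

variable {R V G : Type} [Ring R] [Algebra ℂ R] [AddCommGroup V] [Module ℂ V]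
    [Group G] {K : KoszulDatum R V G}

namespace KoszulDatum

variable (P : ∀ j, K.Univ j)

/-- The Koszul complex. -/
def cplx : ChainComplex (ModuleCat R) ℕ :=
  ChainComplex.of (fun j => ModuleCat.of R (P j).carrier) (fun j => ModuleCat.ofHom (diff P j))
    (fun j => by
      rw [← ModuleCat.ofHom_comp, diff_comp_diff]
      rfl)

theorem cplx_d (j : ℕ) : (cplx P).d (j + 1) j = ModuleCat.ofHom (diff P j) :=
  ChainComplex.of_d (fun j => ModuleCat.of R (P j).carrier) (fun j => ModuleCat.ofHom (diff P j)) j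

theorem exists_resolution [Fintype G] (c : K.Contraction) (N : K.Aug) :
    ∃ Q : ProjectiveResolution (ModuleCat.of R N.carrier), Q.complex = cplx P := by
  obtain ⟨ε, -, hε, hex, hsurj⟩ := exists_aug P N
  let π : cplx P ⟶ (ChainComplex.single₀ (ModuleCat R)).obj (ModuleCat.of R N.carrier) :=
    (ChainComplex.toSingle₀Equiv _ _).symm ⟨ModuleCat.ofHom ε, by
      rw [cplx_d]
      refine (ModuleCat.ofHom_comp _ _).symm.trans ?_
      rw [hε]
      rfl⟩
  have hπ : QuasiIso π := by
    refine ⟨fun m => ?_⟩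
    cases m with
    | zero =>
      rw [ChainComplex.quasiIsoAt₀_iff, ShortComplex.quasiIso_iff_of_zeros' _ rfl rfl rfl]
      constructor
      · rw [ShortComplex.moduleCat_exact_iff]
        intro x hx
        have h1 : π.f 0 = ModuleCat.ofHom ε := ChainComplex.toSingle₀Equiv_symm_apply_f_zero _ _
        obtain ⟨y, hy⟩ := hex x (by
          have h2 : (π.f 0).hom x = 0 := hx
          rw [h1] at h2
          exact h2)
        refine ⟨y, ?_⟩
        have h2 : ((cplx P).d 1 0).hom y = x := by
          rw [cplx_d]
          exact hy
        exact h2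
      · have h1 : π.f 0 = ModuleCat.ofHom ε := ChainComplex.toSingle₀Equiv_symm_apply_f_zero _ _
        have h2 : Epi (π.f 0) := by
          rw [h1]
          exact (ModuleCat.epi_iff_surjective (ModuleCat.ofHom ε)).2 hsurj
        exact h2
    | succ m =>
      rw [quasiIsoAt_iff_exactAt' (hL := ChainComplex.exactAt_succ_single_obj ..),
        HomologicalComplex.exactAt_iff' _ (m + 2) (m + 1) m (by simp) (by simp),
        ShortComplex.moduleCat_exact_iff]
      intro x hx
      obtain ⟨y, hy⟩ := exact_diff P c (x := x) (by
        have h2 : ((cplx P).d (m + 1) m).hom x = 0 := hx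
        rw [cplx_d] at h2
        exact h2)
      refine ⟨y, ?_⟩
      have h2 : ((cplx P).d (m + 2) (m + 1)).hom y = x := by
        rw [cplx_d]
        exact hy
      exact h2
  exact ⟨{ complex := cplx P
           projective := fun j => (IsProjective.iff_projective _).1 (P j).proj
           π := π
           quasiIso := hπ }, rfl⟩

end KoszulDatum

theorem CochainComplex.nonempty_equiv_homology (C : CochainComplex (ModuleCat ℂ) ℕ) {i : ℕ}
    {X : Type} [AddCommGroup X] [Module ℂ X] (ψ : X →ₗ[ℂ] C.X i)
    (h0 : ∀ x, (C.d i (i + 1)).hom (ψ x) = 0)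
    (hs : ∀ z, (C.d i (i + 1)).hom z = 0 → ∃ x k y, z - ψ x = (C.d k i).hom y)
    (hi : ∀ x k y, ψ x = (C.d k i).hom y → x = 0) :
    Nonempty (X ≃ₗ[ℂ] (C.homology i : Type)) := by
  have hnext : (ComplexShape.up ℕ).next i = i + 1 := by simp
  have hd : ∀ k y, ∃ y', (C.d k i).hom y = (C.d ((ComplexShape.up ℕ).prev i) i).hom y' := by
    intro k y
    by_cases hk : (ComplexShape.up ℕ).Rel k i
    · have := (ComplexShape.up ℕ).prev_eq' hk
      subst this
      exact ⟨y, rfl⟩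
    · refine ⟨0, ?_⟩
      rw [C.shape _ _ hk, map_zero]
      rfl
  let ψ' : X →ₗ[ℂ] LinearMap.ker (C.sc i).g.hom := ψ.codRestrict _ fun x => by
    have h1 : (C.d i ((ComplexShape.up ℕ).next i)).hom (ψ x) = 0 := by
      rw [hnext]
      exact h0 x
    exact h1
  let Φ : X →ₗ[ℂ] (LinearMap.ker (C.sc i).g.hom ⧸ LinearMap.range (C.sc i).moduleCatToCycles) :=
    (LinearMap.range (C.sc i).moduleCatToCycles).mkQ ∘ₗ ψ'
  have hΦ : Function.Bijective Φ := by
    constructor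
    · rw [injective_iff_map_eq_zero]
      intro x hx
      obtain ⟨y, hy⟩ := (Submodule.Quotient.mk_eq_zero _).1 hx
      exact hi x _ y (congrArg Subtype.val hy).symm
    · intro z
      obtain ⟨⟨z, hz⟩, rfl⟩ := Submodule.mkQ_surjective _ z
      have h1 : (C.d i ((ComplexShape.up ℕ).next i)).hom z = 0 := hz
      rw [hnext] at h1
      obtain ⟨x, k, y, h⟩ := hs z h1
      obtain ⟨y', hy'⟩ := hd k y
      refine ⟨x, ?_⟩
      have h2 : (⟨z, hz⟩ - ψ' x : LinearMap.ker (C.sc i).g.hom) ∈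
          LinearMap.range (C.sc i).moduleCatToCycles := ⟨y', Subtype.ext (h.trans hy').symm⟩
      exact ((Submodule.Quotient.eq _).2 h2).symm
  exact ⟨(LinearEquiv.ofBijective Φ hΦ).trans
    ((C.sc i).moduleCatHomologyIso).symm.toLinearEquiv⟩

end Resolution

section Extension

variable {R V G : Type} [Ring R] [Algebra ℂ R] [AddCommGroup V] [Module ℂ V]
    [Group G] (K : KoszulDatum R V G)

namespace KoszulDatum

/-- The coboundaries of invariant forms. -/
def icobd (M : Type) [AddCommGroup M] [Module ℂ M] [Module R M] [IsScalarTower ℂ R M] :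
    (j : ℕ) → Submodule ℂ (V [⋀^Fin j]→ₗ[ℂ] M)
  | 0 => ⊥
  | j + 1 => (K.inv M j).map (kd (K.op M) j)

variable {K} (P : ∀ j, K.Univ j)
  {M : Type} [AddCommGroup M] [Module ℂ M] [Module R M] [IsScalarTower ℂ R M]

/-- The morphism represented by a form. -/
def Univ.homOfForm {j : ℕ} (U : K.Univ j) (f : K.inv M j) :
    ModuleCat.of R U.carrier ⟶ ModuleCat.of R M :=
  ModuleCat.ofHom (U.exists_form_eq f.2).choose

theorem Univ.form_homOfForm {j : ℕ} (U : K.Univ j) (f : K.inv M j) :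
    U.form (M := M) (U.homOfForm f).hom = f :=
  (U.exists_form_eq f.2).choose_spec

/-- The morphism represented by a form, as a linear map. -/
def Univ.ofForm {j : ℕ} (U : K.Univ j) :
    K.inv M j →ₗ[ℂ] (((linearYoneda ℂ (ModuleCat R)).obj (ModuleCat.of R M)).obj
      (Opposite.op (ModuleCat.of R U.carrier)) : ModuleCat ℂ) where
  toFun f := U.homOfForm f
  map_add' f f' := by
    refine ModuleCat.hom_ext (U.form_injective (M := M) ?_)
    refine (U.form_homOfForm (f + f')).trans ?_
    exact (congrArg₂ (· + ·) (U.form_homOfForm f) (U.form_homOfForm f')).symm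
  map_smul' r f := by
    refine ModuleCat.hom_ext (U.form_injective (M := M) ?_)
    refine (U.form_homOfForm (r • f)).trans ?_
    refine (congrArg (r • ·) (U.form_homOfForm f)).symm.trans ?_
    ext v
    exact (algebraMap_smul R r ((U.homOfForm f).hom (U.u v) : M)).symm

theorem nonempty_equiv_ext [Fintype G] [FiniteDimensional ℂ V] (c : K.Contraction) (N : K.Aug)
    (i : ℕ) {X : Type} [AddCommGroup X] [Module ℂ X] (Ψ : X →ₗ[ℂ] V [⋀^Fin i]→ₗ[ℂ] M)
    (hΨ : ∀ x, Ψ x ∈ K.inv M i) (h0 : ∀ x, kd (K.op M) i (Ψ x) = 0)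
    (hs : ∀ f ∈ K.inv M i, kd (K.op M) i f = 0 → ∃ x, f - Ψ x ∈ K.icobd M i)
    (hi : ∀ x, Ψ x ∈ K.icobd M i → x = 0) :
    Nonempty (X ≃ₗ[ℂ] (((Ext ℂ (ModuleCat R) i).obj (Opposite.op (ModuleCat.of R N.carrier))).obj
      (ModuleCat.of R M) : Type)) := by
  let P : ∀ j, K.Univ j := fun j => (K.nonempty_univ j).some
  obtain ⟨Q, hQ⟩ := exists_resolution P c N
  have key : Nonempty (X ≃ₗ[ℂ]
      (((cplx P).linearYonedaObj ℂ (ModuleCat.of R M)).homology i : Type)) := by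
    have hd : ∀ (j : ℕ) (φ : ModuleCat.of R (P j).carrier ⟶ ModuleCat.of R M),
        (((cplx P).linearYonedaObj ℂ (ModuleCat.of R M)).d j (j + 1)).hom φ =
          ModuleCat.ofHom (φ.hom ∘ₗ diff P j) := by
      intro j φ
      have h1 : (((cplx P).linearYonedaObj ℂ (ModuleCat.of R M)).d j (j + 1)).hom φ =
        (cplx P).d (j + 1) j ≫ φ := rfl
      rw [h1, cplx_d]
      rfl
    refine CochainComplex.nonempty_equiv_homology _ (X := X)
      ((P i).ofForm ∘ₗ Ψ.codRestrict _ hΨ) ?_ ?_ ?_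
    · intro x
      refine (hd _ _).trans ?_
      refine ModuleCat.hom_ext ((P (i + 1)).form_injective (M := M) ?_)
      refine (form_comp_diff P _).trans ?_
      refine (congrArg _ ((P i).form_homOfForm _)).trans ((h0 x).trans ?_)
      rfl
    · intro z hz
      have hz' : kd (K.op M) i ((P i).form (M := M) (ModuleCat.Hom.hom z)) = 0 := by
        refine (form_comp_diff P _).symm.trans ?_
        have h1 := (hd i z).symm.trans hz
        have h2 := congrArg (fun φ => (P (i + 1)).form (M := M) (ModuleCat.Hom.hom φ)) h1
        exact h2.trans rfl
      obtain ⟨x, hx⟩ := hs _ ((P i).form_mem (M := M) (ModuleCat.Hom.hom z)) hz'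
      cases i with
      | zero =>
        refine ⟨x, 0, 0, ?_⟩
        rw [map_zero]
        refine ModuleCat.hom_ext ((P 0).form_injective (M := M) ?_)
        have h1 := (Submodule.mem_bot _).1 hx
        refine Eq.trans ?_ (h1.trans ?_)
        · exact congrArg (fun f => (P 0).form (M := M) (ModuleCat.Hom.hom z) - f)
            ((P 0).form_homOfForm _)
        · rfl
      | succ j =>
        obtain ⟨f', hf', hf⟩ := hx
        refine ⟨x, j, (P j).ofForm ⟨f', hf'⟩, ?_⟩
        refine Eq.trans ?_ (hd j _).symm
        refine ModuleCat.hom_ext ((P (j + 1)).form_injective (M := M) ?_)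
        refine Eq.trans ?_ (form_comp_diff P _).symm
        refine Eq.trans ?_ (congrArg (kd (K.op M) j) ((P j).form_homOfForm _).symm)
        refine Eq.trans ?_ hf.symm
        exact congrArg (fun f => (P (j + 1)).form (M := M) (ModuleCat.Hom.hom z) - f)
            ((P (j + 1)).form_homOfForm _)
    · intro x k y h
      refine hi x ?_
      by_cases hk : k + 1 = i
      · subst hk
        refine ⟨_, (P k).form_mem (M := M) (ModuleCat.Hom.hom y), ?_⟩
        refine (form_comp_diff P _).symm.trans ?_
        have h1 := h.trans (hd k y)
        have h2 := congrArg (fun φ => (P (k + 1)).form (M := M) (ModuleCat.Hom.hom φ)) h1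
        exact h2.symm.trans ((P (k + 1)).form_homOfForm _)
      · rw [HomologicalComplex.shape _ _ _ (by simpa using hk)] at h
        have h2 := congrArg (fun φ => (P i).form (M := M) (ModuleCat.Hom.hom φ)) h
        have h3 : Ψ x = 0 := ((P i).form_homOfForm _).symm.trans (h2.trans rfl)
        rw [h3]
        exact Submodule.zero_mem _
  rw [← hQ] at key
  exact ⟨key.some.trans (Q.isoExt i (ModuleCat.of R M)).symm.toLinearEquiv⟩

end KoszulDatum

end Extension

section CrossedProduct

/-- A presentation of `D` as the crossed product of `A` with a group of automorphisms which
preserve the generators. -/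
structure CrossedProd {V A : Type} [AddCommGroup V] [Module ℂ V] [Ring A] [Algebra ℂ A]
    (W : WeylGen V A) (G D : Type) [Group G] [Fintype G] [DecidableEq G] [Ring D]
    [Algebra ℂ D] where
  /-- The action on the generators. -/
  σ : Representation ℂ G V
  /-- The action on the algebra. -/
  act : G →* (A ≃ₐ[ℂ] A)
  act_gen : ∀ g v, act g (W.gen v) = W.gen (σ g v)
  /-- The inclusion of the summands. -/
  t : G → A →ₗ[ℂ] D
  /-- The projection to the summands. -/
  comp : G → D →ₗ[ℂ] A
  t_mul_t : ∀ g h a b, t g a * t h b = t (g * h) (a * act g b)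
  t_one : t 1 1 = 1
  comp_t : ∀ g h a, comp g (t h a) = if g = h then a else 0
  sum_t : ∀ d, ∑ g, t g (comp g d) = d

variable {V A G D : Type} [AddCommGroup V] [Module ℂ V] [Ring A] [Algebra ℂ A]
    {W : WeylGen V A} [Group G] [Fintype G] [DecidableEq G] [Ring D] [Algebra ℂ D]
    (C : CrossedProd W G D)

namespace CrossedProd

/-- The inclusion of the generators. -/
def x : V →ₗ[ℂ] D := C.t 1 ∘ₗ W.gen

theorem x_apply (v : V) : C.x v = C.t 1 (W.gen v) := rfl

/-- The inclusion of the group. -/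
def u (g : G) : D := C.t g 1

theorem u_mul_u (g h : G) : C.u g * C.u h = C.u (g * h) := by
  simp [u, C.t_mul_t]

theorem u_one : C.u 1 = 1 := C.t_one

theorem u_mul_x (g : G) (v : V) : C.u g * C.x v = C.x (C.σ g v) * C.u g := by
  simp [u, x, C.t_mul_t, C.act_gen]

theorem x_mul_x (v w : V) : C.x v * C.x w = C.x w * C.x v + algebraMap ℂ D (W.form v w) := by
  simp only [x_apply, C.t_mul_t, map_one, AlgEquiv.one_apply, mul_one]
  rw [W.comm, map_add, Algebra.algebraMap_eq_smul_one, map_smul, C.t_one,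
    Algebra.algebraMap_eq_smul_one]

theorem t_eq (g : G) (a : A) : C.t g a = C.t 1 a * C.u g := by
  simp [u, C.t_mul_t]

theorem form_σ (hA : Function.Injective (algebraMap ℂ A)) (g : G) (v w : V) :
    W.form (C.σ g v) (C.σ g w) = W.form v w := by
  have h1 := congrArg (C.act g) (W.comm v w)
  rw [map_mul, map_add, map_mul, C.act_gen, C.act_gen, W.comm, AlgEquiv.commutes] at h1
  exact hA (add_left_cancel h1)

theorem x_u_induction {p : D → Prop} (hx : ∀ v, p (C.x v)) (hu : ∀ g, p (C.u g))
    (hadd : ∀ a b, p a → p b → p (a + b)) (hmul : ∀ a b, p a → p b → p (a * b))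
    (hc : ∀ c : ℂ, p (algebraMap ℂ D c)) (d : D) : p d := by
  have h0 : p 0 := by simpa using hc 0
  have h1 : ∀ a, p (C.t 1 a) := by
    intro a
    have ha : a ∈ Algebra.adjoin ℂ (Set.range W.gen) := W.adjoin ▸ Algebra.mem_top
    induction ha using Algebra.adjoin_induction with
    | mem y hy =>
      obtain ⟨v, rfl⟩ := hy
      exact hx v
    | algebraMap r =>
      rw [Algebra.algebraMap_eq_smul_one, map_smul, C.t_one, ← Algebra.algebraMap_eq_smul_one]
      exact hc r
    | add y z _ _ hy hz => rw [map_add]; exact hadd _ _ hy hz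
    | mul y z _ _ hy hz =>
      have : C.t 1 (y * z) = C.t 1 y * C.t 1 z := by simp [C.t_mul_t]
      rw [this]
      exact hmul _ _ hy hz
  rw [← C.sum_t d]
  refine Finset.sum_induction _ p (fun a b => hadd a b) h0 fun g _ => ?_
  rw [C.t_eq]
  exact hmul _ _ (h1 _) (hu _)

/-- The associated commuting elements of the enveloping algebra. -/
def koszul : KoszulDatum (env D) V G where
  τ := (TensorProduct.mk ℂ D Dᵐᵒᵖ).flip 1 ∘ₗ C.x -
    TensorProduct.mk ℂ D Dᵐᵒᵖ 1 ∘ₗ (MulOpposite.opLinearEquiv ℂ).toLinearMap ∘ₗ C.x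
  γ :=
    { toFun := fun g => C.u g ⊗ₜ op (C.u g⁻¹)
      map_one' := by rw [inv_one, C.u_one]; rfl
      map_mul' := fun g h => by
        rw [Algebra.TensorProduct.tmul_mul_tmul, ← op_mul, C.u_mul_u, C.u_mul_u, mul_inv_rev] }
  σ := C.σ
  comm v w := by
    simp only [LinearMap.sub_apply, LinearMap.comp_apply, LinearMap.flip_apply,
      TensorProduct.mk_apply, LinearEquiv.coe_coe, MulOpposite.coe_opLinearEquiv, sub_mul, mul_sub,
      Algebra.TensorProduct.tmul_mul_tmul, one_mul, mul_one, ← op_mul]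
    rw [C.x_mul_x v w, TensorProduct.add_tmul, MulOpposite.op_add, TensorProduct.tmul_add,
      Algebra.algebraMap_eq_smul_one, MulOpposite.op_smul, TensorProduct.smul_tmul, op_one]
    abel
  γ_mul g v := by
    have h1 : C.x v * C.u g⁻¹ = C.u g⁻¹ * C.x (C.σ g v) := by
      rw [C.u_mul_x, ← Module.End.mul_apply, ← map_mul, inv_mul_cancel, map_one,
        Module.End.one_apply]
    simp only [LinearMap.sub_apply, LinearMap.comp_apply, LinearMap.flip_apply,
      TensorProduct.mk_apply, LinearEquiv.coe_coe, MulOpposite.coe_opLinearEquiv, MonoidHom.coe_mk,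
      OneHom.coe_mk, sub_mul, mul_sub,
      Algebra.TensorProduct.tmul_mul_tmul, one_mul, mul_one, ← op_mul]
    rw [C.u_mul_x, h1]

theorem koszul_τ (v : V) : C.koszul.τ v = C.x v ⊗ₜ 1 - 1 ⊗ₜ op (C.x v) := rfl

theorem koszul_γ (g : G) : C.koszul.γ g = C.u g ⊗ₜ op (C.u g⁻¹) := rfl

attribute [local instance] TensorProduct.Algebra.module

theorem isScalarTower_env : IsScalarTower ℂ (env D) D where
  smul_assoc c r d := by
    induction r using TensorProduct.induction_on with
    | zero => rw [smul_zero, zero_smul (env D) d, smul_zero]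
    | tmul a b =>
      rw [TensorProduct.smul_tmul', TensorProduct.Algebra.smul_def, TensorProduct.Algebra.smul_def,
        smul_assoc]
    | add a b ha hb => rw [smul_add, add_smul, ha, hb, add_smul, smul_add]

/-- The augmentation module. -/
def aug : C.koszul.Aug where
  carrier := D
  one := 1
  τ_smul v := by
    rw [koszul_τ, sub_smul, TensorProduct.Algebra.smul_def, TensorProduct.Algebra.smul_def]
    simp
  γ_smul g := by
    rw [koszul_γ, TensorProduct.Algebra.smul_def]
    simp [C.u_mul_u, C.u_one]
  gen d := ⟨d ⊗ₜ 1, by rw [TensorProduct.Algebra.smul_def]; simp⟩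
  lift {M} _ _ m hτ hγ := by
    have h1 : ∀ b : D, (b ⊗ₜ[ℂ] (1 : Dᵐᵒᵖ)) • m = ((1 : D) ⊗ₜ[ℂ] op b) • m := by
      refine C.x_u_induction (fun v => ?_) (fun g => ?_) (fun a b ha hb => ?_)
        (fun a b ha hb => ?_) (fun c => ?_)
      · rw [← sub_eq_zero, ← sub_smul]
        exact hτ v
      · conv_rhs => rw [← hγ g, koszul_γ, smul_smul, Algebra.TensorProduct.tmul_mul_tmul, one_mul,
          ← op_mul, C.u_mul_u, inv_mul_cancel, C.u_one, op_one]
      · rw [TensorProduct.add_tmul, add_smul, MulOpposite.op_add, TensorProduct.tmul_add, add_smul, ha, hb]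
      · have e1 : (a * b) ⊗ₜ[ℂ] (1 : Dᵐᵒᵖ) = a ⊗ₜ 1 * b ⊗ₜ 1 := by simp
        have e2 : a ⊗ₜ[ℂ] (1 : Dᵐᵒᵖ) * (1 : D) ⊗ₜ[ℂ] op b = 1 ⊗ₜ op b * a ⊗ₜ 1 := by simp
        have e3 : (1 : D) ⊗ₜ[ℂ] op (a * b) = 1 ⊗ₜ op b * 1 ⊗ₜ op a := by simp
        rw [e1, mul_smul, hb, smul_smul, e2, mul_smul, ha, smul_smul, e3]
      · rw [Algebra.algebraMap_eq_smul_one, MulOpposite.op_smul, TensorProduct.smul_tmul, op_one]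
    refine ⟨{ toFun := fun d => (d ⊗ₜ[ℂ] (1 : Dᵐᵒᵖ)) • m
              map_add' := fun d d' => by rw [TensorProduct.add_tmul, add_smul]
              map_smul' := fun r d => ?_ }, one_smul (env D) m⟩
    induction r using TensorProduct.induction_on with
    | zero => rw [RingHom.id_apply, zero_smul (env D) d, TensorProduct.zero_tmul,
        zero_smul (env D) m, zero_smul (env D) (_ : M)]
    | add r s hr hs => rw [add_smul, TensorProduct.add_tmul, add_smul, hr, hs, RingHom.id_apply,
        RingHom.id_apply, RingHom.id_apply, add_smul]
    | tmul a b =>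
      rw [TensorProduct.Algebra.smul_def, RingHom.id_apply, smul_smul,
        Algebra.TensorProduct.tmul_mul_tmul, mul_one]
      have e1 : (a • b • d) ⊗ₜ[ℂ] (1 : Dᵐᵒᵖ) = (a * d) ⊗ₜ 1 * b.unop ⊗ₜ 1 := by
        simp [mul_assoc]
      have e2 : (a * d) ⊗ₜ[ℂ] (1 : Dᵐᵒᵖ) * 1 ⊗ₜ op (b.unop) = (a * d) ⊗ₜ b := by simp
      rw [e1, mul_smul, h1, smul_smul, e2]

end CrossedProd

end CrossedProduct

section CrossedProduct

variable {V A G D : Type} [AddCommGroup V] [Module ℂ V] [Ring A] [Algebra ℂ A]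
    {W : WeylGen V A} [Group G] [Fintype G] [DecidableEq G] [Ring D] [Algebra ℂ D]
    (C : CrossedProd W G D)

theorem WeylGen.sum_form_smul (W : WeylGen V A)
    {ι : Type} [Fintype ι] (b : Module.Basis ι ℂ V) {w : ι → V}
    (hw : ∀ i v, W.form v (w i) = b.coord i v) (v : V) : ∑ i, W.form (b i) v • w i = v := by
  have hexp : ∀ v, ∑ i, W.form v (w i) • b i = v := fun v => by
    simp only [hw]
    exact b.sum_repr v
  rw [← sub_eq_zero]
  refine W.nondeg _ fun z => ?_
  rw [map_sub, map_sum, sub_eq_zero]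
  simp only [map_smul, smul_eq_mul]
  conv_rhs => rw [← hexp z]
  simp [mul_comm]

namespace CrossedProd

/-- The commutator with a vector, twisted by the group elements. -/
def tad (y : V) : Module.End ℂ D := ∑ g, C.t g ∘ₗ W.ad (C.σ g y) ∘ₗ C.comp g

theorem tad_t (y : V) (g : G) (a : A) : C.tad y (C.t g a) = C.t g (W.ad (C.σ g y) a) := by
  rw [tad, LinearMap.sum_apply, Finset.sum_eq_single g]
  · simp [C.comp_t]
  · intro h _ hh
    simp [C.comp_t, hh]
  · simp

theorem t_mul_x (g : G) (a : A) (v : V) : C.t g a * C.x v = C.t g (a * W.gen (C.σ g v)) := by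
  rw [x_apply, C.t_mul_t, mul_one, C.act_gen]

theorem t_induction {p : D → Prop} (ht : ∀ g a, p (C.t g a)) (h0 : p 0)
    (hadd : ∀ a b, p a → p b → p (a + b)) (d : D) : p d := by
  rw [← C.sum_t d]
  exact Finset.sum_induction _ p (fun a b => hadd a b) h0 fun g _ => ht _ _

theorem tad_mul_x (hA : Function.Injective (algebraMap ℂ A)) (y v : V) (d : D) :
    C.tad y (d * C.x v) = C.tad y d * C.x v + W.form y v • d := by
  refine C.t_induction (p := fun d => C.tad y (d * C.x v) = C.tad y d * C.x v + W.form y v • d)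
    (fun g a => ?_) ?_ (fun a b ha hb => ?_) d
  · rw [t_mul_x, tad_t, tad_t, t_mul_x, ← map_smul, ← map_add, ← C.form_σ hA g]
    congr 1
    have := W.comm (C.σ g y) (C.σ g v)
    rw [W.ad_apply, W.ad_apply, Algebra.smul_def, Algebra.commutes, eq_sub_of_add_eq' this.symm]
    noncomm_ring
  · simp only [zero_mul, map_zero, smul_zero, add_zero]
  · rw [add_mul, map_add, map_add, ha, hb, add_mul, smul_add]
    abel

/-- The filtration by degree on the enveloping algebra. -/
def efil (d : ℕ) : Submodule ℂ (D ⊗[ℂ] Dᵐᵒᵖ) :=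
  Submodule.span ℂ {r | ∃ g, ∃ a ∈ W.fil (d + 1), ∃ x, r = C.t g a ⊗ₜ x}

theorem tmul_mem_efil {d : ℕ} (g : G) {a : A} (ha : a ∈ W.fil (d + 1)) (x : Dᵐᵒᵖ) :
    C.t g a ⊗ₜ x ∈ C.efil d :=
  Submodule.subset_span ⟨g, a, ha, x, rfl⟩

theorem efil_mono : Monotone C.efil := by
  intro d d' h
  refine Submodule.span_mono ?_
  rintro r ⟨g, a, ha, x, rfl⟩
  exact ⟨g, a, W.fil_mono (by omega) ha, x, rfl⟩

theorem exists_mem_efil (r : D ⊗[ℂ] Dᵐᵒᵖ) : ∃ d, r ∈ C.efil d := by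
  have hadd : ∀ r r', (∃ d, r ∈ C.efil d) → (∃ d, r' ∈ C.efil d) → ∃ d, r + r' ∈ C.efil d := by
    rintro r r' ⟨d, hd⟩ ⟨d', hd'⟩
    exact ⟨max d d', add_mem (C.efil_mono (le_max_left _ _) hd)
      (C.efil_mono (le_max_right _ _) hd')⟩
  induction r using TensorProduct.induction_on with
  | zero => exact ⟨0, zero_mem _⟩
  | add r s hr hs => exact hadd _ _ hr hs
  | tmul y z =>
    refine C.t_induction (p := fun y => ∃ d, y ⊗ₜ[ℂ] z ∈ C.efil d) (fun g a => ?_) ?_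
      (fun a b ha hb => ?_) y
    · obtain ⟨d, hd⟩ := W.exists_mem_fil a
      exact ⟨d, C.tmul_mem_efil g hd z⟩
    · rw [TensorProduct.zero_tmul]
      exact ⟨0, zero_mem _⟩
    · rw [TensorProduct.add_tmul]
      exact hadd _ _ ha hb

theorem nonempty_contraction [FiniteDimensional ℂ V] (hA : Function.Injective (algebraMap ℂ A)) :
    Nonempty C.koszul.Contraction := by
  let b := Module.finBasis ℂ V
  obtain ⟨w, hw⟩ := W.exists_dual_basis b
  have hexp := W.sum_form_smul b hw
  let s : Fin (Module.finrank ℂ V) → Module.End ℂ (D ⊗[ℂ] Dᵐᵒᵖ) := fun k =>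
    (C.tad (b k)).rTensor Dᵐᵒᵖ
  have hs : ∀ k g a x, s k (C.t g a ⊗ₜ x) * C.koszul.τ (w k) =
      C.t g (W.ad (C.σ g (b k)) a * W.gen (C.σ g (w k))) ⊗ₜ x -
        C.t g (W.ad (C.σ g (b k)) a) ⊗ₜ (x * op (C.x (w k))) := by
    intro k g a x
    rw [koszul_τ, LinearMap.rTensor_tmul, tad_t, mul_sub, Algebra.TensorProduct.tmul_mul_tmul,
      Algebra.TensorProduct.tmul_mul_tmul, t_mul_x, mul_one, mul_one]
  refine ⟨{ κ := Fin (Module.finrank ℂ V), s := s, u := w, θ := fun k => W.form (b k),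
            s_mul := fun k r v => ?_, sum_smul := hexp, bijective := fun j hj => ?_ }⟩
  · induction r using TensorProduct.induction_on with
    | zero => simp
    | add r r' hr hr' =>
      rw [add_mul, map_add, map_add, hr, hr', add_mul, smul_add]
      abel
    | tmul y z =>
      rw [koszul_τ, mul_sub, mul_sub]
      simp only [Algebra.TensorProduct.tmul_mul_tmul, map_sub, mul_one, s, LinearMap.rTensor_tmul]
      rw [C.tad_mul_x hA, TensorProduct.add_tmul, TensorProduct.smul_tmul']
      abel
  · let N : Module.End ℂ (D ⊗[ℂ] Dᵐᵒᵖ) :=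
      ∑ k, LinearMap.mulRight ℂ (C.koszul.τ (w k)) * s k + (j : ℂ) • 1
    have hN : ∀ r, N r = ∑ k, s k r * C.koszul.τ (w k) + (j : ℂ) • r := fun r => by
      simp [N, LinearMap.sum_apply]
    have hN' : (fun r => ∑ k, s k r * C.koszul.τ (w k) + (j : ℂ) • r) = N :=
      funext fun r => (hN r).symm
    rw [hN']
    refine apply_bijective_of_filtration (N := N) (F := C.efil) hj C.exists_mem_efil ?_ ?_
    · intro r hr
      rw [hN, add_eq_right]
      refine Finset.sum_eq_zero fun k _ => ?_
      induction hr using Submodule.span_induction with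
      | zero => simp
      | add r r' _ _ hr hr' => rw [map_add, add_mul, hr, hr', add_zero]
      | smul c r _ hr => rw [map_smul, smul_mul_assoc, hr, smul_zero]
      | mem r hr =>
        obtain ⟨g, a, ha, x, rfl⟩ := hr
        have h0 := (Submodule.mem_bot ℂ).1 (W.ad_mem (C.σ g (b k)) ha)
        rw [hs, h0]
        simp
    · intro d r hr
      induction hr using Submodule.span_induction with
      | zero => simp
      | add r r' _ _ hr hr' =>
        rw [map_add, smul_add, add_sub_add_comm]
        exact add_mem hr hr'
      | smul c r _ hr =>
        have := Submodule.smul_mem (C.efil d) c hr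
        rwa [smul_sub, smul_comm, ← map_smul N c r] at this
      | mem r hr =>
        obtain ⟨g, a, ha, x, rfl⟩ := hr
        have hexp' : ∀ v, ∑ k, W.form (C.σ g (b k)) v • C.σ g (w k) = v := by
          intro v
          have h1 : C.σ g (C.σ g⁻¹ v) = v := by
            rw [← Module.End.mul_apply, ← map_mul, mul_inv_cancel, map_one, Module.End.one_apply]
          conv_lhs => rw [← h1]
          simp only [C.form_σ hA, ← map_smul, ← map_sum]
          rw [hexp, h1]
        have h1 := W.euler_mem (fun k => C.σ g (w k)) (fun k => C.σ g (b k)) hexp' ha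
        have h2 : ∑ k, W.ad (C.σ g (b k)) a * W.gen (C.σ g (w k)) - ((d + 1 : ℕ) : ℂ) • a ∈
            W.fil (d + 1) := by
          have : ∑ k, W.ad (C.σ g (b k)) a * W.gen (C.σ g (w k)) - ((d + 1 : ℕ) : ℂ) • a =
            (∑ k, W.gen (C.σ g (w k)) * W.ad (C.σ g (b k)) a - ((d + 1 : ℕ) : ℂ) • a) -
              ∑ k, W.ad (C.σ g (w k)) (W.ad (C.σ g (b k)) a) := by
            simp only [W.ad_apply (C.σ g (w _)), Finset.sum_sub_distrib]
            abel
          rw [this]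
          refine sub_mem h1 (Submodule.sum_mem _ fun k _ => ?_)
          exact W.fil_le_succ _ (W.ad_mem _ (W.ad_mem _ ha))
        have h3 : N (C.t g a ⊗ₜ x) - ((j + (d + 1) : ℕ) : ℂ) • (C.t g a ⊗ₜ x) =
            C.t g (∑ k, W.ad (C.σ g (b k)) a * W.gen (C.σ g (w k)) - ((d + 1 : ℕ) : ℂ) • a) ⊗ₜ x -
              ∑ k, C.t g (W.ad (C.σ g (b k)) a) ⊗ₜ (x * op (C.x (w k))) := by
          rw [hN]
          simp only [hs, Finset.sum_sub_distrib, map_sub, map_sum, TensorProduct.sub_tmul,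
            TensorProduct.sum_tmul, map_smul, TensorProduct.smul_tmul']
          rw [Nat.cast_add, add_smul, TensorProduct.add_tmul]
          abel
        rw [h3]
        exact sub_mem (C.tmul_mem_efil g h2 x)
          (Submodule.sum_mem _ fun k _ => C.tmul_mem_efil g (W.ad_mem _ ha) _)

end CrossedProd

end CrossedProduct

section CrossedProduct

theorem sum_range_nsmul_pow_mul {R : Type} [Ring R] (y : R) (n : ℕ) :
    (∑ k ∈ Finset.range n, k • y ^ k) * (1 - y) + n • y ^ n =
      y * ∑ k ∈ Finset.range n, y ^ k := by
  induction n with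
  | zero => simp
  | succ n ih =>
    rw [Finset.sum_range_succ, Finset.sum_range_succ, mul_add, ← ih, ← pow_succ', add_mul,
      smul_mul_assoc, mul_sub (y ^ n), mul_one, ← pow_succ, add_smul, one_smul, smul_sub]
    abel

variable {V A G D : Type} [AddCommGroup V] [Module ℂ V] [Ring A] [Algebra ℂ A]
    {W : WeylGen V A} [Group G] [Fintype G] [DecidableEq G] [Ring D] [Algebra ℂ D]
    (C : CrossedProd W G D)

namespace CrossedProd

/-- The projection to the vectors fixed by a group element. -/
def proj (g : G) : V →ₗ[ℂ] V :=
  (Fintype.card G : ℂ)⁻¹ • ∑ k ∈ Finset.range (Fintype.card G), C.σ g ^ k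

theorem σ_mul_apply (g h : G) (v : V) : C.σ (g * h) v = C.σ g (C.σ h v) := by
  rw [map_mul, Module.End.mul_apply]

theorem σ_self_inv (g : G) (v : V) : C.σ g (C.σ g⁻¹ v) = v := by
  rw [← σ_mul_apply, mul_inv_cancel, map_one, Module.End.one_apply]

theorem σ_inv_self (g : G) (v : V) : C.σ g⁻¹ (C.σ g v) = v := by
  rw [← σ_mul_apply, inv_mul_cancel, map_one, Module.End.one_apply]

theorem proj_apply (g : G) (v : V) : C.proj g v =
    (Fintype.card G : ℂ)⁻¹ • ∑ k ∈ Finset.range (Fintype.card G), C.σ (g ^ k) v := by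
  simp [proj, LinearMap.sum_apply]

theorem card_ne_zero {G : Type} [Group G] [Fintype G] : (Fintype.card G : ℂ) ≠ 0 := Nat.cast_ne_zero.2 Fintype.card_ne_zero

theorem σ_pow_of_fixed {g : G} {v : V} (h : C.σ g v = v) (k : ℕ) : C.σ (g ^ k) v = v := by
  induction k with
  | zero => simp
  | succ k ih => rw [pow_succ, σ_mul_apply, h, ih]

theorem proj_of_fixed {g : G} {v : V} (h : C.σ g v = v) : C.proj g v = v := by
  simp only [proj_apply, C.σ_pow_of_fixed h, Finset.sum_const, Finset.card_range]
  rw [← Nat.cast_smul_eq_nsmul ℂ, inv_smul_smul₀ card_ne_zero]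

theorem σ_mul_geom_sum (g : G) :
    C.σ g * ∑ k ∈ Finset.range (Fintype.card G), C.σ g ^ k =
      ∑ k ∈ Finset.range (Fintype.card G), C.σ g ^ k := by
  have := mul_geom_sum (C.σ g) (Fintype.card G)
  rw [← map_pow, pow_card_eq_one, map_one, sub_self, sub_mul, one_mul, sub_eq_zero] at this
  exact this

theorem σ_proj (g : G) (v : V) : C.σ g (C.proj g v) = C.proj g v := by
  have : C.σ g * C.proj g = C.proj g := by rw [proj, mul_smul_comm, σ_mul_geom_sum]
  exact LinearMap.congr_fun this v

theorem conj_proj (h g : G) (v : V) : C.σ h (C.proj g v) = C.proj (h * g * h⁻¹) (C.σ h v) := by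
  rw [proj_apply, proj_apply, map_smul, map_sum]
  congr 1
  refine Finset.sum_congr rfl fun k _ => ?_
  rw [conj_pow, ← σ_mul_apply, ← σ_mul_apply, inv_mul_cancel_right]

theorem form_proj_proj (hA : Function.Injective (algebraMap ℂ A)) (g : G) (v w : V) :
    W.form (C.proj g v) (C.proj g w) = W.form v (C.proj g w) ∧
      W.form (C.proj g v) (C.proj g w) = W.form (C.proj g v) w := by
  have h (k : ℕ) (w : V) := C.σ_pow_of_fixed (C.σ_proj g w) k
  have h1 (k : ℕ) : W.form (C.σ (g ^ k) v) (C.proj g w) = W.form v (C.proj g w) := by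
    conv_lhs => rw [← h k w, C.form_σ hA]
  have h2 (k : ℕ) : W.form (C.proj g v) (C.σ (g ^ k) w) = W.form (C.proj g v) w := by
    conv_lhs => rw [← h k v, C.form_σ hA]
  constructor
  · rw [C.proj_apply g v]
    simp only [map_smul, map_sum, LinearMap.smul_apply, LinearMap.sum_apply, h1]
    simp
  · rw [C.proj_apply g w]
    simp only [map_smul, map_sum, h2]
    simp

/-- A partial inverse of `1 - g`. -/
def partialInv (g : G) : V →ₗ[ℂ] V :=
  -((Fintype.card G : ℂ)⁻¹ • ∑ k ∈ Finset.range (Fintype.card G), k • C.σ g ^ k)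

theorem partialInv_mul (g : G) : C.partialInv g * (1 - C.σ g) = 1 - C.proj g := by
  have := sum_range_nsmul_pow_mul (C.σ g) (Fintype.card G)
  rw [σ_mul_geom_sum, ← map_pow, pow_card_eq_one, map_one, ← eq_sub_iff_add_eq] at this
  rw [partialInv, neg_mul, smul_mul_assoc, this, proj, smul_sub, ← Nat.cast_smul_eq_nsmul ℂ,
    inv_smul_smul₀ card_ne_zero, neg_sub]

theorem mul_partialInv (g : G) : (1 - C.σ g) * C.partialInv g = 1 - C.proj g := by
  rw [← partialInv_mul]
  refine Commute.neg_right (Commute.smul_right (Commute.sum_right _ _ _ fun k _ => ?_) _)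
  exact ((Commute.one_left _).sub_left ((Commute.refl _).pow_right k)).smul_right k

/-- The decomposition of the space of generators by a group element. -/
def split (hA : Function.Injective (algebraMap ℂ A)) (g : G) : W.Split (C.σ g) where
  P := C.proj g
  B := C.partialInv g
  form_map := C.form_σ hA g
  idem := LinearMap.ext fun v => C.proj_of_fixed (C.σ_proj g v)
  map_P := C.σ_proj g
  sub_B := LinearMap.congr_fun (C.mul_partialInv g)
  B_sub := LinearMap.congr_fun (C.partialInv_mul g)
  form_P v w := by
    obtain ⟨h1, h2⟩ := C.form_proj_proj hA g v w
    rw [← h1, h2]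

theorem codim_conj (hA : Function.Injective (algebraMap ℂ A)) (h g : G) :
    (C.split hA (h * g * h⁻¹)).codim = (C.split hA g).codim := by
  let e : V ≃ₗ[ℂ] V := LinearEquiv.ofLinearMap (C.σ h) (C.σ h⁻¹)
    (LinearMap.ext (C.σ_self_inv h)) (LinearMap.ext (C.σ_inv_self h))
  have : (LinearMap.ker (C.proj g)).map e.toLinearMap = LinearMap.ker (C.proj (h * g * h⁻¹)) := by
    ext v
    constructor
    · rintro ⟨w, hw, rfl⟩
      refine (C.conj_proj h g w).symm.trans ?_
      rw [LinearMap.mem_ker.1 hw, map_zero]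
    · intro hv
      refine ⟨C.σ h⁻¹ v, ?_, C.σ_self_inv h v⟩
      refine LinearMap.mem_ker.2 ?_
      have h1 := C.conj_proj h⁻¹ (h * g * h⁻¹) v
      rw [LinearMap.mem_ker.1 hv, map_zero] at h1
      rw [h1]
      congr 2
      group
  exact (congrArg (fun E : Submodule ℂ V => Module.finrank ℂ E) this.symm).trans
    (e.submoduleMap _).finrank_eq.symm

theorem vol_conj (hA : Function.Injective (algebraMap ℂ A)) (h g : G) {j : ℕ}
    {f : V [⋀^Fin j]→ₗ[ℂ] ℂ} (hf : f ∈ (C.split hA (h * g * h⁻¹)).vol j) :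
    f.compLinearMap (C.σ h) ∈ (C.split hA g).vol j := by
  refine ⟨?_, fun hj => ?_⟩
  · ext v
    conv_rhs => rw [← hf.1]
    simp only [AlternatingMap.compLinearMap_apply]
    congr 1
    funext i
    change C.σ h (v i - C.proj g (v i)) = C.σ h (v i) - C.proj _ (C.σ h (v i))
    rw [map_sub, conj_proj]
  · rw [hf.2 (by rwa [codim_conj]), AlternatingMap.zero_compLinearMap]

end CrossedProd

end CrossedProduct

section CrossedProduct

variable {V A G D : Type} [AddCommGroup V] [Module ℂ V] [Ring A] [Algebra ℂ A]
    {W : WeylGen V A} [Group G] [Fintype G] [DecidableEq G] [Ring D] [Algebra ℂ D]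
    (C : CrossedProd W G D)

namespace CrossedProd

attribute [local instance] TensorProduct.Algebra.module isScalarTower_env

theorem koszul_op_apply (v : V) (d : D) : C.koszul.op D v d = C.x v * d - d * C.x v := by
  rw [KoszulDatum.op_apply, koszul_τ, sub_smul, TensorProduct.Algebra.smul_def,
    TensorProduct.Algebra.smul_def]
  simp

theorem koszul_op_t (g : G) (v : V) (a : A) :
    C.koszul.op D v (C.t g a) = C.t g (W.tw (C.σ g) v a) := by
  rw [koszul_op_apply, t_mul_x, x_apply, C.t_mul_t, W.tw_apply, map_sub]
  simp

theorem comp_koszul_op (g : G) (v : V) (d : D) :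
    C.comp g (C.koszul.op D v d) = W.tw (C.σ g) v (C.comp g d) := by
  refine C.t_induction
    (p := fun d => C.comp g (C.koszul.op D v d) = W.tw (C.σ g) v (C.comp g d))
    (fun h a => ?_) (by simp) (fun a b ha hb => ?_) d
  · rw [koszul_op_t, C.comp_t, C.comp_t]
    split_ifs with hh
    · rw [hh]
    · rw [map_zero]
  · rw [map_add, map_add, ha, hb, map_add, map_add]

theorem koszul_γ_smul_t (h g : G) (a : A) :
    C.koszul.γ h • C.t g a = C.t (h * g * h⁻¹) (C.act h a) := by
  rw [koszul_γ, TensorProduct.Algebra.smul_def]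
  simp [u, C.t_mul_t, mul_assoc]

theorem comp_γ_smul (h g : G) (d : D) :
    C.comp (h * g * h⁻¹) (C.koszul.γ h • d) = C.act h (C.comp g d) := by
  refine C.t_induction
    (p := fun d => C.comp (h * g * h⁻¹) (C.koszul.γ h • d) = C.act h (C.comp g d))
    (fun k a => ?_) (by simp) (fun a b ha hb => ?_) d
  · rw [koszul_γ_smul_t, C.comp_t, C.comp_t]
    by_cases hh : g = k
    · rw [if_pos hh, if_pos (by rw [hh])]
    · rw [if_neg hh, if_neg (by simpa using hh), map_zero]
  · rw [smul_add, map_add, map_add, ha, hb, map_add]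

/-- The equivariant families of volume forms. -/
def vols (hA : Function.Injective (algebraMap ℂ A)) (j : ℕ) :
    Submodule ℂ (G → V [⋀^Fin j]→ₗ[ℂ] ℂ) where
  carrier := {f | (∀ g, f g ∈ (C.split hA g).vol j) ∧
    ∀ h g, (f (h * g * h⁻¹)).compLinearMap (C.σ h) = f g}
  add_mem' {f f'} hf hf' := ⟨fun g => add_mem (hf.1 g) (hf'.1 g), fun h g => by
    rw [Pi.add_apply, AlternatingMap.add_compLinearMap, hf.2, hf'.2, Pi.add_apply]⟩
  zero_mem' := ⟨fun g => zero_mem _, fun h g => AlternatingMap.zero_compLinearMap _⟩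
  smul_mem' c f hf := ⟨fun g => Submodule.smul_mem _ c (hf.1 g), fun h g => by
    refine Eq.trans ?_ (congrArg (c • ·) (hf.2 h g))
    ext; simp⟩

/-- The form with values in the crossed product associated with a family of forms. -/
def total (j : ℕ) : (G → V [⋀^Fin j]→ₗ[ℂ] ℂ) →ₗ[ℂ] V [⋀^Fin j]→ₗ[ℂ] D :=
  ∑ g, (C.t g).compAlternatingMapₗ ℂ ∘ₗ inc V A j ∘ₗ LinearMap.proj g

theorem total_apply {j : ℕ} (f : G → V [⋀^Fin j]→ₗ[ℂ] ℂ) (v : Fin j → V) :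
    C.total j f v = ∑ g, C.t g (algebraMap ℂ A (f g v)) := by
  rw [total, LinearMap.sum_apply, alternatingMap_sum_apply]
  rfl

theorem comp_total {j : ℕ} (f : G → V [⋀^Fin j]→ₗ[ℂ] ℂ) (g : G) :
    (C.comp g).compAlternatingMap (C.total j f) = inc V A j (f g) := by
  ext v
  rw [LinearMap.compAlternatingMap_apply, total_apply, map_sum, Finset.sum_eq_single g]
  · rw [C.comp_t, if_pos rfl, inc_apply]
  · intro h _ hh
    rw [C.comp_t, if_neg hh.symm]
  · simp

theorem total_mem_inv (hA : Function.Injective (algebraMap ℂ A)) {j : ℕ}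
    {f : G → V [⋀^Fin j]→ₗ[ℂ] ℂ} (hf : f ∈ C.vols hA j) : C.total j f ∈ C.koszul.inv D j := by
  intro h v
  rw [total_apply, total_apply, Finset.smul_sum]
  refine Fintype.sum_equiv (MulAut.conj h).toEquiv _ _ fun g => ?_
  rw [koszul_γ_smul_t, AlgEquiv.commutes, ← hf.2 h g]
  rfl

theorem sum_t_comp {j : ℕ} (f : V [⋀^Fin j]→ₗ[ℂ] D) :
    ∑ g, (C.t g).compAlternatingMap ((C.comp g).compAlternatingMap f) = f := by
  ext v
  rw [alternatingMap_sum_apply]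
  exact C.sum_t (f v)

theorem exists_vols_sub_mem [FiniteDimensional ℂ V] (hA : Function.Injective (algebraMap ℂ A))
    {j : ℕ} {f : V [⋀^Fin j]→ₗ[ℂ] D} (hf : f ∈ C.koszul.inv D j)
    (hd : kd (C.koszul.op D) j f = 0) :
    ∃ f' ∈ C.vols hA j, f - C.total j f' ∈ cobd (C.koszul.op D) j := by
  have h1 : ∀ g, ∃ f' ∈ (C.split hA g).vol j,
      (C.comp g).compAlternatingMap f - inc V A j f' ∈ cobd (W.tw (C.σ g)) j := by
    intro g
    refine ((C.split hA g).inc_cocycle_and_exists_and_unique hA j).2.1 _ ?_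
    rw [kd_natural (C.koszul.op D) _ _ fun v d => (C.comp_koszul_op g v d).symm, hd]
    ext; simp
  choose f' hf' hc using h1
  refine ⟨f', ⟨hf', fun h g => ?_⟩, ?_⟩
  · rw [← sub_eq_zero]
    refine ((C.split hA g).inc_cocycle_and_exists_and_unique hA j).2.2 _
      (sub_mem (C.vol_conj hA h g (hf' _)) (hf' g)) ?_
    have h2 := cobd_transport (W.tw (C.σ (h * g * h⁻¹))) (W.tw (C.σ g))
      (C.act h⁻¹).toLinearMap (C.σ h) (fun v a => ?_) (hc (h * g * h⁻¹))
    · have h3 := sub_mem (hc g) h2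
      convert h3 using 1
      ext v
      have h4 : (C.act h⁻¹) (C.comp (h * g * h⁻¹) (f fun i => C.σ h (v i))) = C.comp g (f v) := by
        have h5 : f (fun i => C.σ h (v i)) = C.koszul.γ h • f v := (hf h v).symm
        rw [h5, comp_γ_smul, ← AlgEquiv.mul_apply, ← map_mul, inv_mul_cancel, map_one,
          AlgEquiv.one_apply]
      simp only [AlternatingMap.sub_apply, LinearMap.compAlternatingMap_apply, inc_apply,
        AlternatingMap.compLinearMap_apply, AlgEquiv.toLinearMap_apply, map_sub,
        AlgEquiv.commutes]
      rw [h4]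
      abel
    · rw [W.tw_apply, W.tw_apply, AlgEquiv.toLinearMap_apply, AlgEquiv.toLinearMap_apply, map_sub,
        map_mul, map_mul, C.act_gen, C.act_gen, σ_inv_self, ← σ_mul_apply, ← σ_mul_apply]
      congr 4
      group
  · rw [← C.sum_t_comp (f - C.total j f')]
    refine Submodule.sum_mem _ fun g _ => ?_
    refine cobd_natural (W.tw (C.σ g)) _ _ (C.koszul_op_t g) ?_
    convert hc g using 1
    rw [← C.comp_total]
    ext v
    simp

theorem nonempty_vols_equiv [FiniteDimensional ℂ V] (hA : Function.Injective (algebraMap ℂ A))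
    (j : ℕ) : Nonempty (C.vols hA j ≃ₗ[ℂ] (HHcoh D j : Type)) := by
  obtain ⟨c⟩ := C.nonempty_contraction hA
  have hcom := C.koszul.op_comm D
  have h0 : ∀ f ∈ C.vols hA j, kd (C.koszul.op D) j (C.total j f) = 0 := by
    intro f hf
    rw [← C.sum_t_comp (kd (C.koszul.op D) j (C.total j f))]
    refine Finset.sum_eq_zero fun g _ => ?_
    rw [← kd_natural (C.koszul.op D) _ _ fun v d => (C.comp_koszul_op g v d).symm, comp_total,
      ((C.split hA g).inc_cocycle_and_exists_and_unique hA j).1 _ (hf.1 g)]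
    ext; simp
  refine KoszulDatum.nonempty_equiv_ext c C.aug j (C.total j ∘ₗ (C.vols hA j).subtype)
    (fun f => C.total_mem_inv hA f.2) (fun f => h0 _ f.2) (fun f hf hd => ?_) (fun f hf => ?_)
  · obtain ⟨f', hf', hc⟩ := C.exists_vols_sub_mem hA hf hd
    refine ⟨⟨f', hf'⟩, ?_⟩
    have hinv : f - C.total j f' ∈ C.koszul.inv D j := sub_mem hf (C.total_mem_inv hA hf')
    change f - C.total j f' ∈ _
    cases j with
    | zero => exact hc
    | succ j =>
      obtain ⟨u, hu⟩ := hc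
      refine ⟨C.koszul.avg j u, C.koszul.avg_mem_inv u, ?_⟩
      rw [KoszulDatum.kd_avg, hu, C.koszul.avg_of_mem_inv hinv]
  · have hc : C.total j f ∈ cobd (C.koszul.op D) j := by
      cases j with
      | zero => exact hf
      | succ j =>
        obtain ⟨u, _, hu⟩ := hf
        exact ⟨u, hu⟩
    refine Subtype.ext (funext fun g => ?_)
    refine ((C.split hA g).inc_cocycle_and_exists_and_unique hA j).2.2 _ (f.2.1 g) ?_
    rw [← C.comp_total]
    exact cobd_natural _ _ _ (fun v d => (C.comp_koszul_op g v d).symm) hc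

end CrossedProd

end CrossedProduct

section Volume

variable {V A : Type} [AddCommGroup V] [Module ℂ V] [Ring A] [Algebra ℂ A] {W : WeylGen V A}

namespace WeylGen.Split

variable {g : V →ₗ[ℂ] V} (s : W.Split g)

theorem P_sub (v : V) : s.P ((1 - s.P) v) = 0 :=
  LinearMap.congr_fun s.idem.mul_one_sub_self v

/-- The projection to the kernel of `P`. -/
def toKer : V →ₗ[ℂ] LinearMap.ker s.P :=
  (1 - s.P).codRestrict _ s.P_sub

theorem toKer_coe (v : LinearMap.ker s.P) : s.toKer v = v :=
  Subtype.ext ((congrArg (fun w => (v : V) - w) v.2).trans (sub_zero _))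

theorem vol_apply {j : ℕ} {f : V [⋀^Fin j]→ₗ[ℂ] ℂ} (hf : f ∈ s.vol j) (v : Fin j → V) :
    f.compLinearMap (LinearMap.ker s.P).subtype (fun i => s.toKer (v i)) = f v :=
  congrArg (fun f => f v) hf.1

variable [FiniteDimensional ℂ V]

theorem finite_and_finrank_vol (j : ℕ) :
    Module.Finite ℂ (s.vol j) ∧ Module.finrank ℂ (s.vol j) = if j = s.codim then 1 else 0 := by
  split_ifs with hj
  · let e : Module.Basis (Fin j) ℂ (LinearMap.ker s.P) :=
      Module.finBasisOfFinrankEq ℂ _ hj.symm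
    let ev : s.vol j →ₗ[ℂ] ℂ :=
      { toFun := fun f => f.1 fun i => e i
        map_add' := fun _ _ => rfl
        map_smul' := fun _ _ => rfl }
    have h1 : Function.Injective ev := by
      rw [injective_iff_map_eq_zero]
      intro f hf
      refine Subtype.ext (AlternatingMap.ext fun v => ?_)
      have h2 : f.1.compLinearMap (LinearMap.ker s.P).subtype e = 0 := hf
      rw [← s.vol_apply f.2 v, AlternatingMap.eq_smul_basis_det e
        (f.1.compLinearMap (LinearMap.ker s.P).subtype), h2, zero_smul]
      rfl
    have h2 : Function.Surjective ev := by
      intro c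
      refine ⟨⟨(c • e.det).compLinearMap s.toKer, ?_, fun h => absurd hj h⟩, ?_⟩
      · ext v
        simp only [AlternatingMap.compLinearMap_apply]
        congr 1
        funext i
        exact s.toKer_coe (s.toKer (v i))
      · change (c • e.det) (fun i => s.toKer (e i)) = c
        simp only [toKer_coe, AlternatingMap.smul_apply]
        rw [e.det_self, smul_eq_mul, mul_one]
    have E := LinearEquiv.ofBijective ev ⟨h1, h2⟩
    exact ⟨Module.Finite.equiv E.symm, E.finrank_eq.trans (Module.finrank_self ℂ)⟩
  · have : Subsingleton (s.vol j) :=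
      ⟨fun f f' => Subtype.ext ((f.2.2 hj).trans (f'.2.2 hj).symm)⟩
    exact ⟨inferInstance, Module.finrank_zero_of_subsingleton⟩

theorem compLinearMap_of_mem_vol {h : V →ₗ[ℂ] V} (hP : h * s.P = s.P * h)
    (hdet : LinearMap.det (h * (1 - s.P) + s.P) = 1) {j : ℕ} {f : V [⋀^Fin j]→ₗ[ℂ] ℂ}
    (hf : f ∈ s.vol j) : f.compLinearMap h = f := by
  by_cases hj : j = s.codim
  swap
  · rw [hf.2 hj, AlternatingMap.zero_compLinearMap]
  have hP' (v : V) : h (s.P v) = s.P (h v) := LinearMap.congr_fun hP v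
  have hE : LinearMap.ker s.P ≤ (LinearMap.ker s.P).comap (h * (1 - s.P) + s.P) := by
    intro v hv
    have hv' : s.P v = 0 := hv
    rw [Submodule.mem_comap, LinearMap.mem_ker]
    simp [hv', ← hP']
  have hrestr : LinearMap.det ((h * (1 - s.P) + s.P).restrict hE) = 1 := by
    rw [LinearMap.det_eq_det_mul_det (LinearMap.ker s.P) _ hE] at hdet
    have h1 : (LinearMap.ker s.P).mapQ (LinearMap.ker s.P) (h * (1 - s.P) + s.P) hE =
        LinearMap.id := by
      refine Submodule.linearMap_qext _ (LinearMap.ext fun v => ?_)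
      refine (Submodule.Quotient.eq _).2 (LinearMap.mem_ker.2 ?_)
      have h2 (w : V) : s.P (s.P w) = s.P w := LinearMap.congr_fun s.idem w
      simp [← hP', h2]
    rwa [h1, LinearMap.det_id, mul_one] at hdet
  let e : Module.Basis (Fin j) ℂ (LinearMap.ker s.P) := Module.finBasisOfFinrankEq ℂ _ hj.symm
  ext v
  rw [AlternatingMap.compLinearMap_apply, ← s.vol_apply hf, ← s.vol_apply hf v]
  have h1 : (fun i => s.toKer (h (v i))) =
      (h * (1 - s.P) + s.P).restrict hE ∘ fun i => s.toKer (v i) := by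
    funext i
    refine Subtype.ext ?_
    have h2 (w : V) : s.P (s.P w) = s.P w := LinearMap.congr_fun s.idem w
    change h (v i) - s.P (h (v i)) =
      h ((v i - s.P (v i)) - s.P (v i - s.P (v i))) + s.P (v i - s.P (v i))
    simp [hP', h2]
  rw [h1, AlternatingMap.eq_smul_basis_det e (f.compLinearMap _), AlternatingMap.smul_apply,
    AlternatingMap.smul_apply, e.det_comp, hrestr, one_mul]

end WeylGen.Split

variable {G D : Type} [Group G] [Fintype G] [DecidableEq G] [Ring D] [Algebra ℂ D]
    (C : CrossedProd W G D)

namespace CrossedProd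

theorem finrank_vols [FiniteDimensional ℂ V] (hA : Function.Injective (algebraMap ℂ A))
    (hdet : ∀ h g, h * g = g * h → LinearMap.det (C.σ h * (1 - C.proj g) + C.proj g) = 1)
    {Q : Type} [Fintype Q] (r : Q → G) (hr : ∀ g, ∃! q, IsConj g (r q)) (j : ℕ) :
    Module.Finite ℂ (C.vols hA j) ∧ Module.finrank ℂ (C.vols hA j) =
      (Finset.univ.filter fun q => j = (C.split hA (r q)).codim).card := by
  have hfin (q : Q) := ((C.split hA (r q)).finite_and_finrank_vol j).1
  let F : C.vols hA j →ₗ[ℂ] (∀ q, (C.split hA (r q)).vol j) :=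
    LinearMap.pi fun q =>
      ((LinearMap.proj (r q)) ∘ₗ (C.vols hA j).subtype).codRestrict _ fun f => f.2.1 (r q)
  have hinj : Function.Injective F := by
    rw [injective_iff_map_eq_zero]
    intro f hf
    refine Subtype.ext (funext fun g => ?_)
    obtain ⟨q, hq, -⟩ := hr g
    obtain ⟨h, hh⟩ := isConj_iff.1 hq
    rw [← f.2.2 h g, hh]
    have h1 : f.1 (r q) = 0 := congrArg Subtype.val (congrFun hf q)
    rw [h1, AlternatingMap.zero_compLinearMap]
    rfl
  have hsurj : Function.Surjective F := by
    intro φ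
    have key : ∀ q g h h', h * g * h⁻¹ = r q → h' * g * h'⁻¹ = r q →
        (φ q).1.compLinearMap (C.σ h) = (φ q).1.compLinearMap (C.σ h') := by
      intro q g h h' hh hh'
      have h1 : h * h'⁻¹ * r q = r q * (h * h'⁻¹) := by
        conv_lhs => rw [← hh']
        rw [← hh]
        group
      have h2 : (φ q).1.compLinearMap (C.σ (h * h'⁻¹)) = (φ q).1 := by
        refine (C.split hA (r q)).compLinearMap_of_mem_vol ?_ (hdet _ _ h1) (φ q).2
        refine LinearMap.ext fun v => (C.conj_proj _ _ v).trans ?_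
        rw [h1, mul_inv_cancel_right]
        rfl
      conv_rhs => rw [← h2]
      ext v
      simp only [AlternatingMap.compLinearMap_apply, ← σ_mul_apply, inv_mul_cancel_right]
    have h1 : ∀ g, ∃ q h, h * g * h⁻¹ = r q := fun g => by
      obtain ⟨q, hq, -⟩ := hr g
      exact ⟨q, isConj_iff.1 hq⟩
    choose p c hc using h1
    have hp : ∀ g q h, h * g * h⁻¹ = r q → p g = q := fun g q h hh =>
      (hr g).unique (isConj_iff.2 ⟨_, hc g⟩) (isConj_iff.2 ⟨h, hh⟩)
    have key' : ∀ g q h, h * g * h⁻¹ = r q →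
        (φ q).1.compLinearMap (C.σ h) = (φ (p g)).1.compLinearMap (C.σ (c g)) := by
      intro g q h hh
      obtain rfl := hp g q h hh
      exact key _ g _ _ hh (hc g)
    refine ⟨⟨fun g => (φ (p g)).1.compLinearMap (C.σ (c g)), fun g => ?_, fun h g => ?_⟩, ?_⟩
    · refine C.vol_conj hA (c g) g ?_
      rw [hc]
      exact (φ (p g)).2
    · refine Eq.trans ?_ (key' g (p (h * g * h⁻¹)) (c (h * g * h⁻¹) * h) ?_)
      · ext v
        simp only [AlternatingMap.compLinearMap_apply, ← σ_mul_apply]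
      · rw [← hc]
        group
    · refine funext fun q => Subtype.ext ?_
      refine (key' (r q) q 1 (by group)).symm.trans ?_
      rw [map_one]
      rfl
  have e := LinearEquiv.ofBijective F ⟨hinj, hsurj⟩
  refine ⟨Module.Finite.equiv e.symm, ?_⟩
  rw [e.finrank_eq, Module.finrank_pi_fintype]
  simp [fun q => ((C.split hA (r q)).finite_and_finrank_vol j).2]

end CrossedProd

end Volume

section Orbits

open Equiv.Perm in
theorem card_quotient_sameCycle {ι : Type} [Fintype ι] [DecidableEq ι] (g : Equiv.Perm ι) :
    Nat.card (Quotient (SameCycle.setoid g)) = g.partition.parts.card := by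
  have hne : ∀ c : g.cycleFactorsFinset, ∃ x, x ∈ (c : Equiv.Perm ι).support := fun c =>
    (mem_cycleFactorsFinset_iff.1 c.2).1.nonempty_support
  choose x hx using hne
  have hcyc : ∀ c : g.cycleFactorsFinset, c = g.cycleOf (x c) := fun c =>
    cycle_is_cycleOf (hx c) c.2
  have hsupp : ∀ c, g (x c) ≠ x c := fun c =>
    mem_support.1 (mem_cycleFactorsFinset_support_le c.2 (hx c))
  let φ : g.cycleFactorsFinset ⊕ {y // g y = y} → Quotient (SameCycle.setoid g) :=
    Sum.elim (fun c => Quotient.mk _ (x c)) (fun y => Quotient.mk _ y.1)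
  have hφ : Function.Bijective φ := by
    constructor
    · rintro (c | y) (c' | y') h
      · have h : SameCycle g (x c) (x c') := Quotient.exact h
        exact congrArg Sum.inl (Subtype.ext ((hcyc c).trans (h.cycleOf_eq.trans (hcyc c').symm)))
      · have h : SameCycle g (x c) y' := Quotient.exact h
        exact absurd (h.apply_eq_self_iff.2 y'.2) (hsupp c)
      · have h : SameCycle g y (x c') := Quotient.exact h
        exact absurd (h.apply_eq_self_iff.1 y.2) (hsupp c')
      · have h : SameCycle g y y' := Quotient.exact h
        exact congrArg Sum.inr (Subtype.ext (h.eq_of_left y.2))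
    · intro q
      induction q using Quotient.inductionOn with | _ y => ?_
      by_cases hy : g y = y
      · exact ⟨Sum.inr ⟨y, hy⟩, rfl⟩
      · let c : g.cycleFactorsFinset :=
          ⟨g.cycleOf y, cycleOf_mem_cycleFactorsFinset_iff.2 (mem_support.2 hy)⟩
        refine ⟨Sum.inl c, Quotient.sound ?_⟩
        exact ((mem_support_cycleOf_iff.1 (hx c)).1).symm
  rw [← Nat.card_congr (Equiv.ofBijective φ hφ), Nat.card_sum, parts_partition, Multiset.card_add,
    Multiset.card_replicate, cycleType_def, Multiset.card_map, Nat.card_eq_fintype_card,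
    Nat.card_eq_fintype_card, Fintype.card_coe, Fintype.card_subtype]
  congr 1
  rw [← Finset.card_compl]
  congr 1
  ext y
  simp

theorem exists_perm_parts_eq {n : ℕ} (q : n.Partition) :
    ∃ g : Equiv.Perm (Fin n), g.partition.parts = q.parts := by
  have hone : q.parts.filter (¬ 2 ≤ ·) =
      Multiset.replicate (Multiset.card (q.parts.filter (¬ 2 ≤ ·))) 1 :=
    Multiset.eq_replicate_card.2 fun b hb => by
      have := q.parts_pos (Multiset.mem_filter.1 hb).1
      have := (Multiset.mem_filter.1 hb).2
      omega
  have hsplit := Multiset.filter_add_not (2 ≤ ·) q.parts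
  have hsum := congrArg Multiset.sum hsplit
  rw [Multiset.sum_add, q.parts_sum, hone, Multiset.sum_replicate, smul_eq_mul, mul_one] at hsum
  obtain ⟨g, hg⟩ : ∃ g : Equiv.Perm (Fin n), g.cycleType = q.parts.filter (2 ≤ ·) := by
    rw [Equiv.Perm.exists_with_cycleType_iff]
    refine ⟨?_, fun a ha => (Multiset.mem_filter.1 ha).2⟩
    rw [Fintype.card_fin]
    omega
  refine ⟨g, ?_⟩
  rw [Equiv.Perm.parts_partition, ← Equiv.Perm.sum_cycleType, hg, Fintype.card_fin]
  conv_rhs => rw [← hsplit, hone]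
  congr 2
  omega

end Orbits

section PermRep

theorem det_eq_one_or_neg_one {ι : Type} [Fintype ι] [DecidableEq ι] (f : Module.End ℂ (ι → ℂ))
    (hf : ∀ a b, f a ⬝ᵥ f b = a ⬝ᵥ b) : LinearMap.det f * LinearMap.det f = 1 := by
  have h : (LinearMap.toMatrix' f).transpose * LinearMap.toMatrix' f = 1 := by
    ext i j
    have := hf (Pi.single i 1) (Pi.single j 1)
    rw [Matrix.mul_apply, Matrix.one_apply]
    simpa [dotProduct, LinearMap.toMatrix'_apply, Pi.single_apply, eq_comm] using this
  have := congrArg Matrix.det h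
  rwa [Matrix.det_mul, Matrix.det_transpose, Matrix.det_one, LinearMap.det_toMatrix'] at this

namespace CrossedProd

section Twist

variable {V A G D : Type} [AddCommGroup V] [Module ℂ V] [Ring A] [Algebra ℂ A]
    {W : WeylGen V A} [Group G] [Fintype G] [DecidableEq G] [Ring D] [Algebra ℂ D]
    (C : CrossedProd W G D)

theorem form_twist (hA : Function.Injective (algebraMap ℂ A)) {h g : G} (hg : h * g = g * h)
    (v w : V) :
    W.form (C.σ h (v - C.proj g v) + C.proj g v) (C.σ h (w - C.proj g w) + C.proj g w) =
      W.form v w := by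
  have hc (v : V) : C.σ h (C.proj g v) = C.proj g (C.σ h v) := by
    rw [C.conj_proj, hg, mul_inv_cancel_right]
  have h1 : W.form (C.σ h (v - C.proj g v)) (C.proj g w) = 0 := by
    obtain ⟨h1, h2⟩ := C.form_proj_proj hA g (C.σ h v) w
    rw [map_sub, hc, map_sub, LinearMap.sub_apply, h1, sub_self]
  have h2 : W.form (C.proj g v) (C.σ h (w - C.proj g w)) = 0 := by
    obtain ⟨h1, h2⟩ := C.form_proj_proj hA g v (C.σ h w)
    rw [map_sub, hc, map_sub, h2, sub_self]
  obtain ⟨h3, h4⟩ := C.form_proj_proj hA g v w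
  rw [map_add, map_add, LinearMap.add_apply, LinearMap.add_apply, h1, h2, C.form_σ hA]
  simp only [map_sub, LinearMap.sub_apply]
  rw [← h3, ← h4]
  ring

end Twist

variable {n : ℕ} {A D : Type} [Ring A] [Algebra ℂ A]
    {W : WeylGen ((Fin n → ℂ) × (Fin n → ℂ)) A} [Ring D] [Algebra ℂ D]
    (C : CrossedProd W (Equiv.Perm (Fin n)) D)

theorem det_twist (hA : Function.Injective (algebraMap ℂ A))
    (hσ : ∀ g a b, C.σ g (a, b) = (fun i => a (g⁻¹ i), fun i => b (g⁻¹ i)))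
    (hform : ∀ a b, W.form (a, 0) (0, b) = a ⬝ᵥ b) (h g : Equiv.Perm (Fin n))
    (hg : h * g = g * h) :
    LinearMap.det (C.σ h * (1 - C.proj g) + C.proj g) = 1 := by
  let s (g : Equiv.Perm (Fin n)) : Module.End ℂ (Fin n → ℂ) := LinearMap.funLeft ℂ ℂ ⇑g⁻¹
  let p : Module.End ℂ (Fin n → ℂ) := (Fintype.card (Equiv.Perm (Fin n)) : ℂ)⁻¹ •
    ∑ k ∈ Finset.range (Fintype.card (Equiv.Perm (Fin n))), s (g ^ k)
  have hs (g) : C.σ g = (s g).prodMap (s g) := LinearMap.ext fun v => hσ g v.1 v.2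
  have hp : C.proj g = p.prodMap p := by
    refine LinearMap.ext fun v => ?_
    rw [proj_apply]
    simp only [hs]
    refine Prod.ext ?_ ?_
    · simp [p, Prod.fst_sum, LinearMap.sum_apply]
    · simp [p, Prod.snd_sum, LinearMap.sum_apply]
  let f : Module.End ℂ (Fin n → ℂ) := s h * (1 - p) + p
  have hf : C.σ h * (1 - C.proj g) + C.proj g = f.prodMap f := by
    rw [hs, hp]
    rfl
  rw [hf, LinearMap.det_prodMap]
  refine det_eq_one_or_neg_one f fun a b => ?_
  rw [← hform, ← hform, ← C.form_twist hA hg (a, 0) (0, b)]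
  have hv (v) : C.σ h (v - C.proj g v) + C.proj g v = f.prodMap f v := by
    rw [← hf]
    rfl
  rw [hv, hv, LinearMap.prodMap_apply, LinearMap.prodMap_apply, map_zero]

theorem codim_eq (hA : Function.Injective (algebraMap ℂ A))
    (hσ : ∀ g a b, C.σ g (a, b) = (fun i => a (g⁻¹ i), fun i => b (g⁻¹ i)))
    (g : Equiv.Perm (Fin n)) :
    (C.split hA g).codim = 2 * (n - g.partition.parts.card) := by
  let O := Quotient (Equiv.Perm.SameCycle.setoid g)
  let m : (O → ℂ) →ₗ[ℂ] (Fin n → ℂ) := LinearMap.funLeft ℂ ℂ (Quotient.mk _)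
  have hm : Function.Injective m :=
    LinearMap.funLeft_injective_of_surjective ℂ ℂ _ Quotient.mk_surjective
  have hrange : LinearMap.range (C.proj g) = LinearMap.range (m.prodMap m) := by
    refine le_antisymm ?_ ?_
    · rintro _ ⟨v, rfl⟩
      have h1 := C.σ_proj g v
      set w := C.proj g v
      have h2 (k : ℤ) : C.σ (g ^ k) w = w := by
        have hmem : g ∈ ({ carrier := {x | C.σ x w = w}
                           one_mem' := by simp
                           mul_mem' := fun {x y} hx hy => by
                            change C.σ (x * y) w = w
                            rw [σ_mul_apply, show C.σ y w = w from hy]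
                            exact hx
                           inv_mem' := fun {x} hx => by
                            change C.σ x⁻¹ w = w
                            conv_lhs => rw [← show C.σ x w = w from hx]
                            exact C.σ_inv_self x w } : Subgroup (Equiv.Perm (Fin n))) := h1
        exact Subgroup.zpow_mem _ hmem k
      have h3 : ∀ i j, Equiv.Perm.SameCycle g i j → w.1 i = w.1 j ∧ w.2 i = w.2 j := by
        rintro i j ⟨k, rfl⟩
        have h4 := (hσ (g ^ k) w.1 w.2).symm.trans (h2 k)
        have h5 := congrFun (congrArg Prod.fst h4) ((g ^ k) i)
        have h6 := congrFun (congrArg Prod.snd h4) ((g ^ k) i)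
        have h7 : (g ^ k)⁻¹ ((g ^ k) i) = i := Equiv.symm_apply_apply _ i
        simp only [h7] at h5 h6
        exact ⟨h5, h6⟩
      exact ⟨(fun o => Quotient.lift w.1 (fun i j hij => (h3 i j hij).1) o,
        fun o => Quotient.lift w.2 (fun i j hij => (h3 i j hij).2) o), rfl⟩
    · rintro _ ⟨⟨a, b⟩, rfl⟩
      refine ⟨_, C.proj_of_fixed ?_⟩
      have h1 (i : Fin n) : (Quotient.mk _ (g⁻¹ i) : O) = Quotient.mk _ i :=
        Quotient.sound (⟨1, by simp⟩ : Equiv.Perm.SameCycle g (g⁻¹ i) i)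
      refine (hσ g _ _).trans (Prod.ext ?_ ?_)
      · exact funext fun i => congrArg a (h1 i)
      · exact funext fun i => congrArg b (h1 i)
  have h1 := LinearMap.finrank_range_add_finrank_ker (C.proj g)
  have hinj : Function.Injective (m.prodMap m) := Function.Injective.prodMap hm hm
  have : Fintype O := Fintype.ofFinite O
  rw [hrange, LinearMap.finrank_range_of_inj hinj, Module.finrank_prod, Module.finrank_prod,
    Module.finrank_fintype_fun_eq_card, Module.finrank_fintype_fun_eq_card, Fintype.card_fin,
    ← Nat.card_eq_fintype_card, card_quotient_sameCycle] at h1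
  change Module.finrank ℂ (LinearMap.ker (C.proj g)) = _
  omega

/-- The dimension of the Hochschild cohomology of the crossed product with the symmetric group. -/
theorem finite_and_finrank_HHcoh (hA : Function.Injective (algebraMap ℂ A))
    (hσ : ∀ g a b, C.σ g (a, b) = (fun i => a (g⁻¹ i), fun i => b (g⁻¹ i)))
    (hform : ∀ a b, W.form (a, 0) (0, b) = a ⬝ᵥ b) (j : ℕ) :
    Module.Finite ℂ (HHcoh D j : Type) ∧ Module.finrank ℂ (HHcoh D j : Type) =
      (Finset.univ.filter fun q : n.Partition => 2 * (n - q.parts.card) = j).card := by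
  choose r hr using fun q : n.Partition => exists_perm_parts_eq q
  have hr' (g : Equiv.Perm (Fin n)) : ∃! q, IsConj g (r q) := by
    refine ⟨⟨g.partition.parts, g.partition.parts_pos, ?_⟩, ?_, fun q hq => ?_⟩
    · rw [g.partition.parts_sum, Fintype.card_fin]
    · refine Equiv.Perm.partition_eq_of_isConj.2 (Nat.Partition.ext ?_)
      rw [hr]
    · refine Nat.Partition.ext ?_
      rw [← hr q, Equiv.Perm.partition_eq_of_isConj.1 hq]
  obtain ⟨h1, h2⟩ := C.finrank_vols hA (C.det_twist hA hσ hform) r hr' j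
  obtain ⟨e⟩ := C.nonempty_vols_equiv hA j
  refine ⟨Module.Finite.equiv e, ?_⟩
  rw [← e.finrank_eq, h2]
  simp only [C.codim_eq hA hσ, hr, eq_comm]

end CrossedProd

end PermRep

section WeylPower

theorem Weyl.x_mul_p : Weyl.x * Weyl.p = Weyl.p * Weyl.x + 1 := by
  simpa [Weyl.x, Weyl.p] using RingQuot.mkAlgHom_rel ℂ weylRel.rel

theorem Weyl.adjoin_x_p : Algebra.adjoin ℂ {Weyl.x, Weyl.p} = ⊤ := by
  have h := congrArg (Subalgebra.map (RingQuot.mkAlgHom ℂ weylRel))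
    (FreeAlgebra.adjoin_range_ι ℂ (Fin 2))
  rw [AlgHom.map_adjoin, Algebra.map_top,
    (AlgHom.range_eq_top _).2 (RingQuot.mkAlgHom_surjective ℂ weylRel), ← Set.range_comp] at h
  rw [← h]
  congr 1
  ext a
  simp [Fin.exists_fin_two, Weyl.x, Weyl.p, eq_comm]

/-- The representation of the Weyl algebra by differential operators. -/
def Weyl.rep : Weyl →ₐ[ℂ] Module.End ℂ (Polynomial ℂ) :=
  RingQuot.liftAlgHom ℂ ⟨FreeAlgebra.lift ℂ ![Polynomial.derivative,
    LinearMap.mulLeft ℂ Polynomial.X], by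
      rintro _ _ ⟨⟩
      refine LinearMap.ext fun f => ?_
      simp [add_comm]⟩

theorem Weyl.one_ne_zero : (1 : Weyl) ≠ 0 := fun h => by
  have := congrArg Weyl.rep h
  rw [map_one, map_zero] at this
  exact _root_.one_ne_zero this

theorem tpow_one_ne_zero {A : Type} [Ring A] [Algebra ℂ A] (h : (1 : A) ≠ 0) (n : ℕ) :
    (1 : tpow A n) ≠ 0 := fun h1 => by
  refine h ((Module.forall_dual_apply_eq_zero_iff ℂ (1 : A)).1 fun f => ?_)
  have h2 := congrArg (PiTensorProduct.lift
    ((MultilinearMap.mkPiAlgebra ℂ (Fin n) ℂ).compLinearMap fun _ => f)) h1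
  rw [PiTensorProduct.one_def, PiTensorProduct.lift.tprod, map_zero] at h2
  simp only [MultilinearMap.compLinearMap_apply, MultilinearMap.mkPiAlgebra_apply, Pi.one_apply,
    Finset.prod_const] at h2
  exact eq_zero_of_pow_eq_zero h2

variable {A : Type} [Ring A] [Algebra ℂ A] {n : ℕ}

theorem adjoin_singleAlgHom {s : Set A} (hs : Algebra.adjoin ℂ s = ⊤) :
    Algebra.adjoin ℂ (⋃ i, PiTensorProduct.singleAlgHom (R := ℂ) (A := fun _ : Fin n => A) i '' s) =
      ⊤ := by
  set S := Algebra.adjoin ℂ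
    (⋃ i, PiTensorProduct.singleAlgHom (R := ℂ) (A := fun _ : Fin n => A) i '' s)
  have h1 (i : Fin n) (a : A) :
      PiTensorProduct.singleAlgHom (R := ℂ) (A := fun _ : Fin n => A) i a ∈ S := by
    have : a ∈ Algebra.adjoin ℂ s := hs ▸ Algebra.mem_top
    have h2 := (Subalgebra.mem_map (f := PiTensorProduct.singleAlgHom (R := ℂ)
      (A := fun _ : Fin n => A) i)).2 ⟨a, this, rfl⟩
    rw [AlgHom.map_adjoin] at h2
    exact Algebra.adjoin_mono (Set.subset_iUnion_of_subset i subset_rfl) h2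
  have h2 (a : Fin n → A) (t : Finset (Fin n)) :
      (PiTensorProduct.tprod ℂ (t.piecewise a 1) : tpow A n) ∈ S := by
    induction t using Finset.induction_on with
    | empty =>
      rw [Finset.piecewise_empty, ← PiTensorProduct.one_def]
      exact S.one_mem
    | insert i t hi ih =>
      have := mul_mem (h1 i (a i)) ih
      refine (congrArg (· ∈ S) ?_).mp this
      refine (PiTensorProduct.tprod_mul_tprod _ _).trans (congrArg _ (funext fun j => ?_))
      by_cases hj : j = i
      · subst hj
        simp [hi]
      · simp [Finset.piecewise, hj]
  rw [← top_le_iff, ← Subalgebra.toSubmodule.le_iff_le, Algebra.top_toSubmodule,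
    ← PiTensorProduct.span_tprod_eq_top, Submodule.span_le]
  rintro _ ⟨a, rfl⟩
  simpa using h2 a Finset.univ

theorem commute_singleAlgHom {i j : Fin n} (hij : i ≠ j) (a b : A) :
    Commute (PiTensorProduct.singleAlgHom (R := ℂ) (A := fun _ : Fin n => A) i a)
      (PiTensorProduct.singleAlgHom (R := ℂ) (A := fun _ : Fin n => A) j b) :=
  Commute.tprod (Pi.mulSingle_commute (f := fun _ : Fin n => A) hij a b)

end WeylPower

section SymplecticGenerators

variable {A ι : Type} [Ring A] [Algebra ℂ A] [Fintype ι]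

/-- The standard symplectic form. -/
def dotForm (ι : Type) [Fintype ι] :
    (ι → ℂ) × (ι → ℂ) →ₗ[ℂ] (ι → ℂ) × (ι → ℂ) →ₗ[ℂ] ℂ :=
  LinearMap.mk₂ ℂ (fun v w => v.1 ⬝ᵥ w.2 - w.1 ⬝ᵥ v.2)
    (fun _ _ _ => by simp; ring) (fun _ _ _ => by simp; ring)
    (fun _ _ _ => by simp; ring) (fun _ _ _ => by simp; ring)

theorem linearCombination_mul_linearCombination {x y : ι → A} (c : Matrix ι ι ℂ)
    (h : ∀ i j, x i * y j = y j * x i + algebraMap ℂ A (c i j)) (a b : ι → ℂ) :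
    Fintype.linearCombination ℂ x a * Fintype.linearCombination ℂ y b =
      Fintype.linearCombination ℂ y b * Fintype.linearCombination ℂ x a +
        algebraMap ℂ A (a ⬝ᵥ c.mulVec b) := by
  simp only [Fintype.linearCombination_apply, Finset.sum_mul_sum, smul_mul_smul_comm, h, smul_add,
    Finset.sum_add_distrib]
  congr 1
  · rw [Finset.sum_comm]
    simp only [mul_comm]
  · simp only [dotProduct, Matrix.mulVec, map_sum, Finset.mul_sum, Algebra.smul_def, ← map_mul]
    exact Finset.sum_congr rfl fun _ _ => Finset.sum_congr rfl fun _ _ => by congr 1; ring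

/-- Generators of an algebra which satisfy the canonical commutation relations. -/
def WeylGen.ofRelations [DecidableEq ι] (x p : ι → A) (hx : ∀ i j, x i * x j = x j * x i)
    (hp : ∀ i j, p i * p j = p j * p i)
    (hxp : ∀ i j, x i * p j = p j * x i + algebraMap ℂ A ((1 : Matrix ι ι ℂ) i j))
    (hadj : Algebra.adjoin ℂ (Set.range x ∪ Set.range p) = ⊤) :
    WeylGen ((ι → ℂ) × (ι → ℂ)) A where
  gen := (Fintype.linearCombination ℂ x).coprod (Fintype.linearCombination ℂ p)
  form := dotForm ι
  comm v w := by
    have h1 := linearCombination_mul_linearCombination (0 : Matrix ι ι ℂ)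
      (x := x) (y := x) (fun i j => by simpa using hx i j) v.1 w.1
    have h2 := linearCombination_mul_linearCombination (0 : Matrix ι ι ℂ)
      (x := p) (y := p) (fun i j => by simpa using hp i j) v.2 w.2
    have h3 := linearCombination_mul_linearCombination 1 hxp v.1 w.2
    have h4 := linearCombination_mul_linearCombination 1 hxp w.1 v.2
    rw [Matrix.zero_mulVec, dotProduct_zero, map_zero, add_zero] at h1 h2
    rw [Matrix.one_mulVec] at h3 h4
    simp only [LinearMap.coprod_apply, dotForm, LinearMap.mk₂_apply, map_sub, add_mul, mul_add,
      h1, h2, h3, h4]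
    abel
  nondeg v h := by
    refine Prod.ext (funext fun i => ?_) (funext fun i => ?_)
    · simpa [dotForm] using h (0, Pi.single i 1)
    · simpa [dotForm] using h (Pi.single i 1, 0)
  adjoin := by
    rw [← top_le_iff, ← hadj]
    refine Algebra.adjoin_mono (Set.union_subset ?_ ?_)
    · rintro _ ⟨i, rfl⟩
      exact ⟨(Pi.single i 1, 0), by simp⟩
    · rintro _ ⟨i, rfl⟩
      exact ⟨(0, Pi.single i 1), by simp⟩

end SymplecticGenerators

section SymmetricGroup

/-- The generators of a tensor power of the Weyl algebra. -/
def tpowWeylGen (n : ℕ) : WeylGen ((Fin n → ℂ) × (Fin n → ℂ)) (tpow Weyl n) :=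
  WeylGen.ofRelations
    (fun i => PiTensorProduct.singleAlgHom (R := ℂ) (A := fun _ : Fin n => Weyl) i Weyl.x)
    (fun i => PiTensorProduct.singleAlgHom (R := ℂ) (A := fun _ : Fin n => Weyl) i Weyl.p)
    (fun i j => by
      by_cases hij : i = j
      · rw [hij]
      · exact commute_singleAlgHom hij _ _)
    (fun i j => by
      by_cases hij : i = j
      · rw [hij]
      · exact commute_singleAlgHom hij _ _)
    (fun i j => by
      by_cases hij : i = j
      · subst hij
        rw [← map_mul, Weyl.x_mul_p, map_add, map_mul, map_one, Matrix.one_apply_eq, map_one]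
      · rw [Matrix.one_apply_ne hij, map_zero, add_zero]
        exact commute_singleAlgHom hij _ _)
    (by
      rw [← adjoin_singleAlgHom Weyl.adjoin_x_p]
      congr 1
      ext a
      simp [exists_or, eq_comm])

theorem tpowWeylGen_gen (n : ℕ) (a b : Fin n → ℂ) : (tpowWeylGen n).gen (a, b) =
    ∑ i, a i • PiTensorProduct.singleAlgHom (R := ℂ) (A := fun _ : Fin n => Weyl) i Weyl.x +
      ∑ i, b i • PiTensorProduct.singleAlgHom (R := ℂ) (A := fun _ : Fin n => Weyl) i Weyl.p := rfl

theorem tpowWeylGen_form (n : ℕ) (a b : Fin n → ℂ) :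
    (tpowWeylGen n).form (a, 0) (0, b) = a ⬝ᵥ b := by
  change a ⬝ᵥ b - (0 : Fin n → ℂ) ⬝ᵥ (0 : Fin n → ℂ) = _
  simp

variable {n : ℕ} (ρ : Equiv.Perm (Fin n) →* (tpow Weyl n ≃ₐ[ℂ] tpow Weyl n))

/-- The permutation representation on the generators. -/
def permRep (n : ℕ) : Representation ℂ (Equiv.Perm (Fin n)) ((Fin n → ℂ) × (Fin n → ℂ)) where
  toFun g := (LinearMap.funLeft ℂ ℂ ⇑g⁻¹).prodMap (LinearMap.funLeft ℂ ℂ ⇑g⁻¹)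
  map_one' := rfl
  map_mul' g h := by
    rw [mul_inv_rev]
    rfl

theorem perm_singleAlgHom
    (hρ : ∀ (σ : Equiv.Perm (Fin n)) (a : Fin n → Weyl),
      ρ σ (PiTensorProduct.tprod ℂ a) = PiTensorProduct.tprod ℂ (fun i => a (σ⁻¹ i)))
    (g : Equiv.Perm (Fin n)) (i : Fin n) (a : Weyl) :
    ρ g (PiTensorProduct.singleAlgHom (R := ℂ) (A := fun _ : Fin n => Weyl) i a) =
      PiTensorProduct.singleAlgHom (R := ℂ) (A := fun _ : Fin n => Weyl) (g i) a := by
  refine (hρ g (Pi.mulSingle i a)).trans (congrArg _ (funext fun j => ?_))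
  simp [Pi.mulSingle_apply, Equiv.symm_apply_eq]

theorem perm_gen
    (hρ : ∀ (σ : Equiv.Perm (Fin n)) (a : Fin n → Weyl),
      ρ σ (PiTensorProduct.tprod ℂ a) = PiTensorProduct.tprod ℂ (fun i => a (σ⁻¹ i)))
    (g : Equiv.Perm (Fin n)) (v : (Fin n → ℂ) × (Fin n → ℂ)) :
    ρ g ((tpowWeylGen n).gen v) = (tpowWeylGen n).gen (permRep n g v) := by
  have key (a : Fin n → ℂ) (y : Weyl) :
      ∑ i, a i • PiTensorProduct.singleAlgHom (R := ℂ) (A := fun _ : Fin n => Weyl) (g i) y =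
      ∑ i, a (g⁻¹ i) • PiTensorProduct.singleAlgHom (R := ℂ) (A := fun _ : Fin n => Weyl) i y := by
    rw [← Equiv.sum_comp g fun i => a (g⁻¹ i) •
      PiTensorProduct.singleAlgHom (R := ℂ) (A := fun _ : Fin n => Weyl) i y]
    refine Finset.sum_congr rfl fun i _ => ?_
    have : g⁻¹ (g i) = i := Equiv.symm_apply_apply g i
    rw [this]
  obtain ⟨a, b⟩ := v
  change _ = (tpowWeylGen n).gen (fun i => a (g⁻¹ i), fun i => b (g⁻¹ i))
  rw [tpowWeylGen_gen, tpowWeylGen_gen, map_add, map_sum, map_sum]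
  simp only [map_smul, perm_singleAlgHom ρ hρ, key]

variable {D : Type} [Ring D] [Algebra ℂ D]
    (e : MonoidAlgebra (tpow Weyl n) (Equiv.Perm (Fin n)) ≃ₗ[ℂ] D)

/-- The crossed product of a tensor power of the Weyl algebra with the symmetric group. -/
def permCrossedProd
    (hρ : ∀ (σ : Equiv.Perm (Fin n)) (a : Fin n → Weyl),
      ρ σ (PiTensorProduct.tprod ℂ a) = PiTensorProduct.tprod ℂ (fun i => a (σ⁻¹ i)))
    (he : ∀ (g h : Equiv.Perm (Fin n)) (a b : tpow Weyl n),
      e (MonoidAlgebra.single g a) * e (MonoidAlgebra.single h b)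
        = e (MonoidAlgebra.single (g * h) (a * ρ g b))) :
    CrossedProd (tpowWeylGen n) (Equiv.Perm (Fin n)) D where
  σ := permRep n
  act := ρ
  act_gen := perm_gen ρ hρ
  t g := e.toLinearMap ∘ₗ MonoidAlgebra.lsingle g
  comp g := Finsupp.lapply g ∘ₗ (MonoidAlgebra.coeffLinearEquiv ℂ).toLinearMap ∘ₗ
    e.symm.toLinearMap
  t_mul_t := he
  t_one := by
    have h1 (d : D) : e (MonoidAlgebra.single 1 1) * d = d := by
      obtain ⟨f, rfl⟩ := e.surjective d
      rw [← MonoidAlgebra.sum_coeff_single f, Finsupp.sum, map_sum, Finset.mul_sum]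
      simp only [he, one_mul, map_one, AlgEquiv.one_apply]
    exact (mul_one _).symm.trans (h1 1)
  comp_t g h a := by
    simp [Finsupp.single_apply, eq_comm]
  sum_t d := by
    obtain ⟨f, rfl⟩ := e.surjective d
    simp only [LinearMap.comp_apply, LinearEquiv.coe_coe, e.symm_apply_apply,
      MonoidAlgebra.lsingle_apply, ← map_sum]
    congr 1
    conv_rhs => rw [← MonoidAlgebra.sum_coeff_single f]
    exact (Finsupp.sum_fintype _ _ fun _ => MonoidAlgebra.single_zero _).symm

end SymmetricGroup

/-- Let `𝒜` be the Weyl algebra, `n ≥ 1`, and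
`D = ℂ[S_n] ⋉ 𝒜^{⊗n}` the crossed product for the permutation action `ρ` of `S_n` on
`𝒜^{⊗n}` (underlying space `𝒜^{⊗n} ⊗ ℂ[S_n]`, identified with
`MonoidAlgebra (𝒜^{⊗n}) S_n` via `e`, multiplication `(a⊗g)(b⊗h) = a·g(b) ⊗ gh`).
Then for every `i ≥ 0` the Hochschild cohomology `HH^i(D)` is finite-dimensional over
`ℂ`, of dimension the number of partitions `λ` of `n` with `2(n - ℓ(λ)) = i` (where
`ℓ(λ)` is the number of parts); in particular it vanishes for odd `i`. -/
theorem statement19 (n : ℕ) (hn : 1 ≤ n)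
    (ρ : Equiv.Perm (Fin n) →* (tpow Weyl n ≃ₐ[ℂ] tpow Weyl n))
    (hρ : ∀ (σ : Equiv.Perm (Fin n)) (a : Fin n → Weyl),
      ρ σ (PiTensorProduct.tprod ℂ a) = PiTensorProduct.tprod ℂ (fun i => a (σ⁻¹ i)))
    (D : Type) [Ring D] [Algebra ℂ D]
    (e : MonoidAlgebra (tpow Weyl n) (Equiv.Perm (Fin n)) ≃ₗ[ℂ] D)
    (he : ∀ (g h : Equiv.Perm (Fin n)) (a b : tpow Weyl n),
      e (MonoidAlgebra.single g a) * e (MonoidAlgebra.single h b)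
        = e (MonoidAlgebra.single (g * h) (a * ρ g b)))
    (i : ℕ) :
    Module.Finite ℂ (HHcoh D i : Type) ∧
    Module.finrank ℂ (HHcoh D i : Type)
      = (Finset.univ.filter (fun lam : Nat.Partition n =>
          2 * (n - lam.parts.card) = i)).card ∧
    (Odd i → Limits.IsZero (HHcoh D i)) := by
  have : Nontrivial (tpow Weyl n) := nontrivial_of_ne _ _ (tpow_one_ne_zero Weyl.one_ne_zero n)
  obtain ⟨hfin, hrank⟩ := (permCrossedProd ρ e hρ he).finite_and_finrank_HHcoh
    (algebraMap ℂ (tpow Weyl n)).injective (fun _ _ _ => rfl) (tpowWeylGen_form n) i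
  refine ⟨hfin, hrank, fun hi => ?_⟩
  rw [Finset.filter_false_of_mem (fun q _ h => ?_), Finset.card_empty] at hrank
  · have := Module.finrank_zero_iff.1 hrank
    exact ModuleCat.isZero_of_subsingleton _
  · exact Nat.not_even_iff_odd.2 hi (h ▸ even_two_mul _)
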